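/- Let k = 3 and let n ∈ ℕ^ℕ contain infinitely many occurrences of the word (1,1,1,1,1), i.e. for infinitely many r one has n_r = n_{r+1} = n_{r+2} = n_{r+3} = n_{r+4} = 1. Then Φ^{-1}(n) = {α} is a singleton, α is an extreme point of DF(n), and α is a smooth extreme point of DF(n): there is exactly one line L through α in the plane {x ∈ ℝ³ : x_0 + x_1 + x_2 = 1} such that DF(n) ∖ L is connected. -/

import Mathlib

open Filter Topology
open scoped Classical

namespace BetaDF

/-- Digit sequences (elements of `Σ = {0,…,k−1}^ℕ` when all entries are `< k`). -/
abbrev Seq : Type := ℕ → ℕ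

/-- Lexicographic (strict) order on digit sequences. -/
def seqLt (v w : Seq) : Prop := ∃ r, (∀ s, s < r → v s = w s) ∧ v r < w r

/-- Lexicographic order on digit sequences. -/
def seqLe (v w : Seq) : Prop := seqLt v w ∨ v = w

/-- The shift map `σ`. -/
def shift (w : Seq) : Seq := fun r => w (r + 1)

/-- Membership in `Σ = {0,…,k−1}^ℕ`. -/
def InSigma (k : ℕ) (w : Seq) : Prop := ∀ r, w r < k

/-- A sequence is maximal if it is `≥` every element of its shift orbit. -/
def IsMaximal (w : Seq) : Prop := ∀ r, seqLe (shift^[r] w) w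

/-- Number of occurrences of the digit `i` among the first `r` entries of `w`. -/
def digitCount (w : Seq) (i r : ℕ) : ℕ := ((Finset.range r).filter fun s => w s = i).card

/-- The ambient Euclidean space `ℝ^k`. -/
abbrev E (k : ℕ) : Type := EuclideanSpace ℝ (Fin k)

/-- The `i`-th coordinate (with junk value `0` for `i ≥ k`). -/
def proj {k : ℕ} (α : E k) (i : ℕ) : ℝ := if h : i < k then α ⟨i, h⟩ else 0

/-- `w` has digit frequency vector `α`. -/
def HasDigitFreq (k : ℕ) (w : Seq) (α : E k) : Prop :=
  ∀ i, i < k →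
    Tendsto (fun r => (digitCount w i r : ℝ) / (r : ℝ)) atTop (𝓝 (proj α i))

/-- The standard `(k−1)`-simplex `Δ`. -/
def simplex (k : ℕ) : Set (E k) := {α | (∀ i : Fin k, 0 ≤ α i) ∧ ∑ i, α i = 1}

/-- The face `F = {α ∈ Δ : α_{k−1} = 0}`. -/
def faceF (k : ℕ) : Set (E k) := {α ∈ simplex k | proj α (k - 1) = 0}

/-- `Δ' = Δ ∖ F`. -/
def simplex' (k : ℕ) : Set (E k) := simplex k \ faceF k

/-- `J(α) = ⌊α₀/α_{k−1}⌋`. -/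
noncomputable def Jfun {k : ℕ} (α : E k) : ℕ := ⌊proj α 0 / proj α (k - 1)⌋₊

/-- The map `K_n`. -/
noncomputable def Kmap {k : ℕ} (n : ℕ) (α : E k) : E k :=
  (WithLp.equiv 2 (Fin k → ℝ)).symm fun i =>
    if (i : ℕ) + 2 < k then proj α ((i : ℕ) + 1) / (1 - proj α 0)
    else if (i : ℕ) + 2 = k then (proj α 0 - n * proj α (k - 1)) / (1 - proj α 0)
    else ((n + 1) * proj α (k - 1) - proj α 0) / (1 - proj α 0)

/-- The continued-fraction map `K : Δ' → Δ'`, `K(α) = K_{J(α)}(α)`. -/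
noncomputable def Kstep {k : ℕ} (α : E k) : E k := Kmap (Jfun α) α

/-- The itinerary map `Φ(α)_r = J(K^r(α))`. -/
noncomputable def Phi {k : ℕ} (α : E k) : ℕ → ℕ := fun r => Jfun (Kstep^[r] α)

/-- The projective embedding `K_n^{-1} : Δ → Δ`. -/
noncomputable def Kinv {k : ℕ} (n : ℕ) (α : E k) : E k :=
  (WithLp.equiv 2 (Fin k → ℝ)).symm fun i =>
    (if (i : ℕ) = 0 then (n + 1) * proj α (k - 2) + n * proj α (k - 1)
      else if (i : ℕ) + 1 = k then proj α (k - 2) + proj α (k - 1)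
      else proj α ((i : ℕ) - 1)) /
      ((n + 1) * proj α (k - 2) + n * proj α (k - 1) + 1)

/-- `Υ_{n,r} = K_{n₀}^{-1} ∘ ⋯ ∘ K_{n_r}^{-1}`. -/
noncomputable def Ups {k : ℕ} (n : ℕ → ℕ) : ℕ → E k → E k
  | 0 => Kinv (n 0)
  | r + 1 => fun α => Ups n r (Kinv (n (r + 1)) α)

/-- `A_{n,r} = Υ_{n,r}(Δ)`. -/
noncomputable def Anr (k : ℕ) (n : ℕ → ℕ) (r : ℕ) : Set (E k) := Ups n r '' simplex k

/-- `F_{n,r} = Υ_{n,r}(F)`. -/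
noncomputable def Fnr (k : ℕ) (n : ℕ → ℕ) (r : ℕ) : Set (E k) := Ups n r '' faceF k

/-- Reverse-lexicographic strict order on `ℕ^ℕ`: `a < b` iff `a` exceeds `b`
at the first index where they differ. -/
def revLexLt (a b : ℕ → ℕ) : Prop := ∃ r, (∀ s, s < r → a s = b s) ∧ b r < a r

/-- The word to which the substitution `Λ_n` sends the digit `i`. -/
def lamWord (k n i : ℕ) : List ℕ :=
  if i + 2 < k then [i + 1]
  else if i + 2 = k then (k - 1) :: List.replicate (n + 1) 0
  else (k - 1) :: List.replicate n 0

/-- The substitution `Λ_n : Σ → Σ`. -/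
def lamSub (k n : ℕ) (w : Seq) : Seq := fun m =>
  (((List.range (m + 1)).map fun r => lamWord k n (w r)).flatten).getD m 0

/-- `Λ_{n,r} = Λ_{n₀} ∘ ⋯ ∘ Λ_{n_r}`. -/
def lamChain (k : ℕ) (n : ℕ → ℕ) : ℕ → Seq → Seq
  | 0 => lamSub k (n 0)
  | r + 1 => fun w => lamChain k n r (lamSub k (n (r + 1)) w)

/-- `Λ_{n₀} ∘ ⋯ ∘ Λ_{n_{R−1}}` for a finite list of indices. -/
def lamList (k : ℕ) : List ℕ → Seq → Seq
  | [], w => w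
  | a :: t, w => lamSub k a (lamList k t w)

/-- The constant sequence `(k−1)(k−1)(k−1)…`. -/
def topSeq (k : ℕ) : Seq := fun _ => k - 1

/-- The sequence `(k−1)000…`. -/
def baseSeq (k : ℕ) : Seq := fun m => if m = 0 then k - 1 else 0

/-- `S(n) = lim_{r→∞} Λ_{n,r}((k−1)(k−1)(k−1)…)` (limit in the product topology). -/
noncomputable def Sseq (k : ℕ) (n : ℕ → ℕ) : Seq :=
  limUnder atTop fun r => lamChain k n r (topSeq k)

/-- The compactified itinerary space `N`: sequences with values in `ℕ∞` such that
all entries from the first `∞` onwards equal `∞`.  Elements with no `∞` entry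
correspond to `ℕ^ℕ`; the others are the finite type elements `n₀…n_{R−1}∞`. -/
def NN : Type := {m : ℕ → ℕ∞ // ∀ r, m r = ⊤ → m (r + 1) = ⊤}

/-- Reverse-lexicographic strict order on `N` (`∞` counts as larger than every natural). -/
def nnLt (m n : NN) : Prop := ∃ r, (∀ s, s < r → m.1 s = n.1 s) ∧ n.1 r < m.1 r

/-- Reverse-lexicographic order on `N`. -/
def nnLe (m n : NN) : Prop := nnLt m n ∨ m = n

/-- The element of `N` determined by an element of `ℕ^ℕ`. -/
def toNN (g : ℕ → ℕ) : NN := ⟨fun r => (g r : ℕ∞), fun r h => absurd h (by simp)⟩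

/-- The itinerary `n₀ … n_{R−1} (n_R + 1) 0 0 0 …` (of rational type). -/
def ratSeq (f : ℕ → ℕ) (R : ℕ) : ℕ → ℕ := fun r =>
  if r < R then f r else if r = R then f R + 1 else 0

/-- The finite type element `n₀ … n_{R−1} n_R ∞` of `N`. -/
def finNN (f : ℕ → ℕ) (R : ℕ) : NN :=
  ⟨fun r => if r ≤ R then (f r : ℕ∞) else ⊤, by
    intro r h
    show (if r + 1 ≤ R then ((f (r + 1) : ℕ∞)) else ⊤) = ⊤
    have h' : (if r ≤ R then ((f r : ℕ∞)) else ⊤) = ⊤ := h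
    by_cases h1 : r ≤ R
    · rw [if_pos h1] at h'
      exact absurd h' (by simp)
    · rw [if_neg (by omega : ¬ r + 1 ≤ R)]⟩

/-- The extension of `S` to `N`. -/
noncomputable def SN (k : ℕ) (m : NN) : Seq :=
  if h : ∃ R, m.1 R = ⊤ then
    lamList k ((List.range (Nat.find h)).map fun r => (m.1 r).toNat) (baseSeq k)
  else Sseq k fun r => (m.1 r).toNat

/-- The metric `d(m,n) = 2^{−X(m,n)}` on `N`, where
`X(m,n) = r + min(m₀+⋯+m_r, n₀+⋯+n_r)` and `r` is the first index where `m,n` differ. -/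
noncomputable def dN (m n : NN) : ℝ :=
  if h : m = n then 0
  else
    have hex : ∃ r, m.1 r ≠ n.1 r := by
      by_contra hc
      push_neg at hc
      exact h (Subtype.ext (funext hc))
    (2 : ℝ) ^ (-(((Nat.find hex : ℕ) : ℤ) +
      ((min (∑ s ∈ Finset.range (Nat.find hex + 1), m.1 s)
            (∑ s ∈ Finset.range (Nat.find hex + 1), n.1 s)).toNat : ℤ)))

/-- The symbolic β-shift `X(w)`. -/
def Xset (k : ℕ) (w : Seq) : Set Seq :=
  {v | InSigma k v ∧ ∀ r, seqLe (shift^[r] v) w}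

/-- The digit frequency set `DF(w)` of the symbolic β-shift `X(w)`. -/
def DFw (k : ℕ) (w : Seq) : Set (E k) :=
  {α | α ∈ simplex k ∧ ∃ v ∈ Xset k w, HasDigitFreq k v α}

/-- `DF(n) = DF(S(n))` for `n ∈ ℕ^ℕ`. -/
noncomputable def DFn (k : ℕ) (n : ℕ → ℕ) : Set (E k) := DFw k (Sseq k n)

/-- `DF(n) = DF(S(n))` for `n ∈ N`. -/
noncomputable def DFN (k : ℕ) (m : NN) : Set (E k) := DFw k (SN k m)

/-- The infimax map `I = S ∘ Φ` on `Δ'`, extended by `I(α) = (k−1)000…` on `F`. -/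
noncomputable def Ifun (k : ℕ) (α : E k) : Seq :=
  if α ∈ simplex' k then Sseq k (Phi α) else baseSeq k

/-- The simplex `T_m = {α ∈ Δ : (m+1)α_{k−1} ≤ α₀}`. -/
def Tset (k m : ℕ) : Set (E k) :=
  {α ∈ simplex k | ((m : ℝ) + 1) * proj α (k - 1) ≤ proj α 0}

/-- The standard basis vector `e_i`. -/
noncomputable def evec (k i : ℕ) : E k :=
  (WithLp.equiv 2 (Fin k → ℝ)).symm fun j => if (j : ℕ) = i then 1 else 0

/-- The rational extreme points
`FE(n) = {Υ_{n,s}(e_{k−2}) : n_{s+t} ≠ 0 for some 1 ≤ t ≤ k−2}`. -/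
noncomputable def FEset (k : ℕ) (n : ℕ → ℕ) : Set (E k) :=
  {α | ∃ s, (∃ t, 1 ≤ t ∧ t ≤ k - 2 ∧ n (s + t) ≠ 0) ∧ α = Ups n s (evec k (k - 2))}

/-- The set `E(n)` of non-trivial extreme points of `DF(n)`:
extreme points other than `e₀,…,e_{k−2}`. -/
noncomputable def Eset (k : ℕ) (n : ℕ → ℕ) : Set (E k) :=
  Set.extremePoints ℝ (DFn k n) \ {α | ∃ i, i ≤ k - 2 ∧ α = evec k i}

/-- The fiber `Φ^{-1}(n) ⊆ Δ'`. -/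
noncomputable def PhiFiber (k : ℕ) (n : ℕ → ℕ) : Set (E k) :=
  {α ∈ simplex' k | Phi α = n}

/-- `f_β(x) = βx mod 1`. -/
noncomputable def fbeta (β x : ℝ) : ℝ := Int.fract (β * x)

/-- The digit sequence of the greedy β-expansion of `x`: `d_β(x)_r = ⌊β f_β^r(x)⌋`. -/
noncomputable def dbeta (β : ℝ) (x : ℝ) : Seq := fun r => ⌊β * (fbeta β)^[r] x⌋₊

/-- The digit frequency set `DF(β)` of β-expansions of points of `[0,1]`. -/
noncomputable def DFbeta (k : ℕ) (β : ℝ) : Set (E k) :=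
  {α | α ∈ simplex k ∧ ∃ x ∈ Set.Icc (0 : ℝ) 1, HasDigitFreq k (dbeta β x) α}

/-- The sequence `w_β`: if `d_β(1) = d₁…d_{r−1}d_r000…` with `d_r > 0` then `w_β`
is the infinite repetition of `d₁…d_{r−1}(d_r − 1)`; otherwise `w_β = d_β(1)`. -/
noncomputable def wbeta (β : ℝ) : Seq :=
  if h : ∃ r, dbeta β 1 r ≠ 0 ∧ ∀ s, r < s → dbeta β 1 s = 0 then
    fun m =>
      if m % (Nat.find h + 1) = Nat.find h then dbeta β 1 (Nat.find h) - 1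
      else dbeta β 1 (m % (Nat.find h + 1))
  else dbeta β 1

/-- `DF` extended to `[k−1,k]` by `DF(k−1) = F` and `DF(k) = Δ`. -/
noncomputable def DFext (k : ℕ) (β : ℝ) : Set (E k) :=
  if β ≤ (k : ℝ) - 1 then faceF k
  else if (k : ℝ) ≤ β then simplex k
  else DFbeta k β

/-- The mode-locking interval `I_{n₀…n_R}` determined by the word `f 0, …, f R`. -/
noncomputable def Iint (k : ℕ) (f : ℕ → ℕ) (R : ℕ) : Set ℝ :=
  {β | (k : ℝ) - 1 < β ∧ β < k ∧
    seqLe (Sseq k (ratSeq f R)) (wbeta β) ∧ seqLe (wbeta β) (SN k (finNN f R))}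

/-- The frequency vector of the first `s` digits of `w`. -/
noncomputable def freqVec (k : ℕ) (w : Seq) (s : ℕ) : E k :=
  (WithLp.equiv 2 (Fin k → ℝ)).symm fun i => (digitCount w (i : ℕ) s : ℝ) / (s : ℝ)


/-! ### Sequences: cons, append and the substitution -/

def consS (a : ℕ) (w : Seq) : Seq
  | 0 => a
  | m + 1 => w m

def appS : List ℕ → Seq → Seq
  | [], w => w
  | a :: l, w => consS a (appS l w)

@[simp] lemma consS_zero (a : ℕ) (w : Seq) : consS a w 0 = a := rfl
@[simp] lemma consS_succ (a : ℕ) (w : Seq) (m : ℕ) : consS a w (m + 1) = w m := rfl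
@[simp] lemma shift_consS (a : ℕ) (w : Seq) : shift (consS a w) = w := rfl
@[simp] lemma appS_nil (w : Seq) : appS [] w = w := rfl
@[simp] lemma appS_cons (a : ℕ) (l : List ℕ) (w : Seq) :
    appS (a :: l) w = consS a (appS l w) := rfl

lemma appS_append (l l' : List ℕ) (w : Seq) : appS (l ++ l') w = appS l (appS l' w) := by
  induction l with
  | nil => rfl
  | cons a l ih => simp [ih]

lemma appS_apply (l : List ℕ) (w : Seq) (m : ℕ) :
    appS l w m = if m < l.length then l.getD m 0 else w (m - l.length) := by
  induction l generalizing m with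
  | nil => simp
  | cons a l ih =>
    cases m with
    | zero => simp
    | succ m => simp [ih]

lemma shift_iter_apply (w : Seq) (j m : ℕ) : (shift^[j] w) m = w (j + m) := by
  induction j generalizing w with
  | zero => simp
  | succ j ih =>
    rw [Function.iterate_succ_apply, ih]
    simp only [shift]
    congr 1; omega

lemma consS_shift (w : Seq) : consS (w 0) (shift w) = w := by
  funext m; cases m <;> rfl

lemma lamWord_zero (n : ℕ) : lamWord 3 n 0 = [1] := by simp [lamWord]
lemma lamWord_one (n : ℕ) : lamWord 3 n 1 = 2 :: List.replicate (n + 1) 0 := by simp [lamWord]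
lemma lamWord_two (n : ℕ) : lamWord 3 n 2 = 2 :: List.replicate n 0 := by simp [lamWord]

lemma lamWord_length_pos (n i : ℕ) : 1 ≤ (lamWord 3 n i).length := by
  unfold lamWord; split_ifs <;> simp

def fl (n : ℕ) (w : Seq) (a : ℕ) : List ℕ :=
  ((List.range a).map fun r => lamWord 3 n (w r)).flatten

lemma fl_succ (n : ℕ) (w : Seq) (a : ℕ) : fl n w (a + 1) = fl n w a ++ lamWord 3 n (w a) := by
  simp [fl, List.range_succ]

lemma fl_succ' (n : ℕ) (w : Seq) (a : ℕ) :
    fl n w (a + 1) = lamWord 3 n (w 0) ++ fl n (shift w) a := by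
  simp [fl, List.range_succ_eq_map, shift, Function.comp_def]

lemma fl_length (n : ℕ) (w : Seq) (a : ℕ) : a ≤ (fl n w a).length := by
  induction a with
  | zero => simp
  | succ a ih =>
    rw [fl_succ, List.length_append]
    have := lamWord_length_pos n (w a)
    omega

lemma fl_stable (n : ℕ) (w : Seq) (i a b : ℕ) (h : i < a) :
    (fl n w (a + b)).getD i 0 = (fl n w a).getD i 0 := by
  induction b with
  | zero => rfl
  | succ b ih =>
    rw [← add_assoc, fl_succ, List.getD_append, ih]
    have := fl_length n w (a + b)
    omega

lemma lamSub_eq (n : ℕ) (w : Seq) :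
    lamSub 3 n w = appS (lamWord 3 n (w 0)) (lamSub 3 n (shift w)) := by
  funext m
  rw [appS_apply]
  change (fl n w (m + 1)).getD m 0 = if _ then _ else
    (fl n (shift w) (m - (lamWord 3 n (w 0)).length + 1)).getD _ 0
  rw [fl_succ']
  have h1 := lamWord_length_pos n (w 0)
  split_ifs with h
  · rw [List.getD_append _ _ _ _ h]
  · push Not at h
    rw [List.getD_append_right _ _ _ _ h]
    obtain ⟨c, hc⟩ : ∃ c, m = (m - (lamWord 3 n (w 0)).length + 1) + c :=
      ⟨(lamWord 3 n (w 0)).length - 1, by omega⟩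
    conv_lhs => rw [hc]
    rw [← hc, hc, fl_stable]
    · congr 2; omega
    · omega

lemma lamSub_lt (n : ℕ) (w : Seq) : InSigma 3 (lamSub 3 n w) := by
  intro m
  unfold lamSub
  rw [List.getD_eq_getElem?_getD]
  rcases hx : (((List.range (m + 1)).map fun r => lamWord 3 n (w r)).flatten)[m]? with _ | x
  · simp
  · have hm := List.mem_of_getElem? hx
    simp only [List.mem_flatten, List.mem_map] at hm
    obtain ⟨l, ⟨r, -, rfl⟩, hxl⟩ := hm
    simp only [Option.getD_some]
    unfold lamWord at hxl
    split_ifs at hxl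
    · simp at hxl; omega
    · simp at hxl; omega
    · simp at hxl; omega

lemma lamSub_local (n : ℕ) (w w' : Seq) (m : ℕ) (h : ∀ s, s ≤ m → w s = w' s) :
    lamSub 3 n w m = lamSub 3 n w' m := by
  unfold lamSub
  have : ((List.range (m + 1)).map fun r => lamWord 3 n (w r)) =
      ((List.range (m + 1)).map fun r => lamWord 3 n (w' r)) := by
    apply List.map_congr_left
    intro a ha
    rw [List.mem_range] at ha
    rw [h a (by omega)]
  rw [this]

lemma lam0 (n : ℕ) {w : Seq} (h : w 0 = 0) : lamSub 3 n w = consS 1 (lamSub 3 n (shift w)) := by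
  rw [lamSub_eq, h, lamWord_zero]; rfl
lemma lam1 (n : ℕ) {w : Seq} (h : w 0 = 1) : lamSub 3 n w =
    consS 2 (appS (List.replicate (n + 1) 0) (lamSub 3 n (shift w))) := by
  rw [lamSub_eq, h, lamWord_one]; rfl
lemma lam2 (n : ℕ) {w : Seq} (h : w 0 = 2) : lamSub 3 n w =
    consS 2 (appS (List.replicate n 0) (lamSub 3 n (shift w))) := by
  rw [lamSub_eq, h, lamWord_two]; rfl

lemma lamSub_head_pos (n : ℕ) {w : Seq} (hw : InSigma 3 w) : 1 ≤ lamSub 3 n w 0 := by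
  have := hw 0
  rcases (by omega : w 0 = 0 ∨ w 0 = 1 ∨ w 0 = 2) with h | h | h
  · rw [lam0 n h]; simp
  · rw [lam1 n h]; simp
  · rw [lam2 n h]; simp

lemma InSigma_shift {w : Seq} (hw : InSigma 3 w) : InSigma 3 (shift w) := fun r => hw (r + 1)
lemma InSigma_iter {w : Seq} (hw : InSigma 3 w) (j : ℕ) : InSigma 3 (shift^[j] w) := by
  intro r; rw [shift_iter_apply]; exact hw _

/-! ### Order -/

lemma seqLt_of_head {v w : Seq} (h : v 0 < w 0) : seqLt v w := ⟨0, by simp, h⟩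

lemma seqLt_cons {a : ℕ} {v w : Seq} (h : seqLt v w) : seqLt (consS a v) (consS a w) := by
  obtain ⟨r, h1, h2⟩ := h
  refine ⟨r + 1, ?_, h2⟩
  intro s hs
  cases s with
  | zero => rfl
  | succ s => exact h1 s (by omega)

lemma seqLt_app {l : List ℕ} {v w : Seq} (h : seqLt v w) : seqLt (appS l v) (appS l w) := by
  induction l with
  | nil => exact h
  | cons a l ih => exact seqLt_cons ih

lemma seqLe_shift {v w : Seq} (h0 : v 0 = w 0) (h : seqLe v w) : seqLe (shift v) (shift w) := by
  rcases h with ⟨r, h1, h2⟩ | rfl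
  · cases r with
    | zero => omega
    | succ r => exact Or.inl ⟨r, fun s hs => h1 (s + 1) (by omega), h2⟩
  · exact Or.inr rfl

lemma seqLe_head {v w : Seq} (h : seqLe v w) : v 0 ≤ w 0 := by
  rcases h with ⟨r, h1, h2⟩ | rfl
  · cases r with
    | zero => omega
    | succ r => exact (h1 0 (by omega)).le
  · rfl

lemma appS_replicate_succ' (n : ℕ) (v : Seq) :
    appS (List.replicate (n + 1) 0) v = appS (List.replicate n 0) (consS 0 v) := by
  rw [List.replicate_succ', appS_append]; rfl

lemma lamSub_seqLt (n : ℕ) : ∀ (r : ℕ) (v w : Seq), InSigma 3 v → InSigma 3 w →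
    (∀ s, s < r → v s = w s) → v r < w r → seqLt (lamSub 3 n v) (lamSub 3 n w) := by
  intro r
  induction r with
  | zero =>
    intro v w hv hw _ h
    have := hw 0
    rcases (by omega : w 0 = 1 ∨ w 0 = 2) with hw0 | hw0
    · rw [lam0 n (by omega : v 0 = 0), lam1 n hw0]
      exact seqLt_of_head (by simp)
    · rcases (by omega : v 0 = 0 ∨ v 0 = 1) with hv0 | hv0
      · rw [lam0 n hv0, lam2 n hw0]
        exact seqLt_of_head (by simp)
      · rw [lam1 n hv0, lam2 n hw0, appS_replicate_succ']
        apply seqLt_cons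
        apply seqLt_app
        apply seqLt_of_head
        have := lamSub_head_pos n (InSigma_shift hw)
        simp only [consS_zero]; omega
  | succ r ih =>
    intro v w hv hw h1 h2
    rw [lamSub_eq n v, lamSub_eq n w, h1 0 (by omega)]
    apply seqLt_app
    exact ih _ _ (InSigma_shift hv) (InSigma_shift hw) (fun s hs => h1 (s + 1) (by omega)) h2

lemma lamSub_seqLe (n : ℕ) {v w : Seq} (hv : InSigma 3 v) (hw : InSigma 3 w) (h : seqLe v w) :
    seqLe (lamSub 3 n v) (lamSub 3 n w) := by
  rcases h with ⟨r, h1, h2⟩ | rfl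
  · exact Or.inl (lamSub_seqLt n r v w hv hw h1 h2)
  · exact Or.inr rfl

lemma shift_app_ge (l : List ℕ) (w : Seq) (m : ℕ) (h : l.length ≤ m) :
    shift^[m] (appS l w) = shift^[m - l.length] w := by
  funext i
  rw [shift_iter_apply, shift_iter_apply, appS_apply, if_neg (by omega)]
  congr 1; omega

lemma lamWord_tail (n i j : ℕ) (h0 : 0 < j) (hj : j < (lamWord 3 n i).length) :
    (lamWord 3 n i).getD j 0 = 0 := by
  obtain ⟨j, rfl⟩ : ∃ j', j = j' + 1 := ⟨j - 1, by omega⟩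
  unfold lamWord at *
  split_ifs at * with h1 h2
  · simp at hj
  · simp [List.getD_eq_getElem?_getD, List.getElem?_replicate]; split_ifs <;> rfl
  · simp [List.getD_eq_getElem?_getD, List.getElem?_replicate]; split_ifs <;> rfl

lemma lam_decomp (n : ℕ) : ∀ (m : ℕ) (v : Seq), InSigma 3 v →
    (shift^[m] (lamSub 3 n v)) 0 < 2 ∨ ∃ j ≤ m, shift^[m] (lamSub 3 n v) = lamSub 3 n (shift^[j] v)
      ∧ (0 < m → 1 ≤ n → 1 ≤ v 0 → j < m) := by
  intro m
  induction m using Nat.strong_induction_on with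
  | _ m ih =>
    intro v hv
    rcases Nat.eq_zero_or_pos m with rfl | hm
    · right; exact ⟨0, le_rfl, rfl, by omega⟩
    · have hl := lamWord_length_pos n (v 0)
      rcases lt_or_ge m (lamWord 3 n (v 0)).length with h | h
      · left
        rw [shift_iter_apply, lamSub_eq, appS_apply, add_zero, if_pos h, lamWord_tail n _ _ hm h]
        omega
      · rw [lamSub_eq n v, shift_app_ge _ _ _ h]
        rcases ih (m - (lamWord 3 n (v 0)).length) (by omega) (shift v) (InSigma_shift hv) with
          h1 | ⟨j, hj, h1, -⟩
        · left; exact h1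
        · right
          refine ⟨j + 1, by omega, ?_, ?_⟩
          · rw [h1, Function.iterate_succ_apply]
          · intro _ hn hv0
            have : 2 ≤ (lamWord 3 n (v 0)).length := by
              have := hv 0
              rcases (by omega : v 0 = 1 ∨ v 0 = 2) with h | h
              · rw [h, lamWord_one]; simp
              · rw [h, lamWord_two]; simp; omega
            omega

lemma lam_mem_X (n : ℕ) {v w : Seq} (hw : InSigma 3 w) (hw0 : w 0 = 2) (hv : v ∈ Xset 3 w) :
    lamSub 3 n v ∈ Xset 3 (lamSub 3 n w) := by
  refine ⟨lamSub_lt n v, fun m => ?_⟩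
  rcases lam_decomp n m v hv.1 with h | ⟨j, -, h, -⟩
  · left; apply seqLt_of_head; rw [lam2 n hw0]; exact h
  · rw [h]; exact lamSub_seqLe n (InSigma_iter hv.1 j) hw (hv.2 j)

lemma lam_mem_X_lt (n j : ℕ) (hj : n < j) {v w : Seq} (hw : InSigma 3 w) (hw0 : w 0 = 2)
    (hv : InSigma 3 v) : lamSub 3 j v ∈ Xset 3 (lamSub 3 n w) := by
  have key : ∀ v : Seq, InSigma 3 v → seqLt (lamSub 3 j v) (lamSub 3 n w) := by
    intro v hv
    have hx := lamSub_head_pos n (InSigma_shift hw)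
    have h3 := hv 0
    have aux : ∀ i (u : Seq), n < i → seqLt (consS 2 (appS (List.replicate i 0) u))
        (consS 2 (appS (List.replicate n 0) (lamSub 3 n (shift w)))) := by
      intro i u hi
      obtain ⟨d, rfl⟩ : ∃ d, i = n + (d + 1) := ⟨i - n - 1, by omega⟩
      rw [List.replicate_add, appS_append]
      apply seqLt_cons; apply seqLt_app; apply seqLt_of_head
      simp only [List.replicate_succ, appS_cons, consS_zero]; omega
    rw [lam2 n hw0]
    rcases (by omega : v 0 = 0 ∨ v 0 = 1 ∨ v 0 = 2) with h | h | h
    · rw [lam0 j h]; exact seqLt_of_head (by simp)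
    · rw [lam1 j h]; exact aux _ _ (by omega)
    · rw [lam2 j h]; exact aux _ _ (by omega)
  refine ⟨lamSub_lt j v, fun m => ?_⟩
  left
  rcases lam_decomp j m v hv with h | ⟨i, -, h, -⟩
  · apply seqLt_of_head; rw [lam2 n hw0]; exact h
  · rw [h]; exact key _ (InSigma_iter hv i)

/-! ### The limit sequence S(n) -/

def H (n : ℕ → ℕ) : Prop := ∀ R, ∃ r, R ≤ r ∧ n r = 1 ∧ n (r + 1) = 1 ∧ n (r + 2) = 1 ∧
      n (r + 3) = 1 ∧ n (r + 4) = 1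

lemma H_shift {n : ℕ → ℕ} (h : H n) : H (shift n) := by
  intro R
  obtain ⟨r, hr, h1, h2, h3, h4, h5⟩ := h (R + 1)
  obtain ⟨r, rfl⟩ : ∃ r', r = r' + 1 := ⟨r - 1, by omega⟩
  exact ⟨r, by omega, h1, h2, h3, h4, h5⟩

lemma lamChain_succ (n : ℕ → ℕ) (r : ℕ) (w : Seq) :
    lamChain 3 n (r + 1) w = lamSub 3 (n 0) (lamChain 3 (shift n) r w) := by
  induction r generalizing w with
  | zero => rfl
  | succ r ih =>
    change lamChain 3 n (r + 1) (lamSub 3 (n (r + 2)) w) = _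
    rw [ih]; rfl

lemma lamChain_head (n : ℕ → ℕ) (r : ℕ) (w : Seq) (h : w 0 = 2) : lamChain 3 n r w 0 = 2 := by
  induction r generalizing w with
  | zero => change lamSub 3 (n 0) w 0 = 2; rw [lam2 _ h]; rfl
  | succ r ih => exact ih _ (by rw [lam2 _ h]; rfl)

def PA (m : ℕ) (n : ℕ → ℕ) : Prop := ∃ R, ∀ r, R ≤ r → ∀ w w' : Seq, w 0 = 2 → w' 0 = 2 →
  ∀ s, s < m → lamChain 3 n r w s = lamChain 3 n r w' s

lemma PA_shift {m : ℕ} {n : ℕ → ℕ} (h : PA m (shift n)) : PA m n := by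
  obtain ⟨R, hR⟩ := h
  refine ⟨R + 1, fun r hr w w' hw hw' s hs => ?_⟩
  obtain ⟨r, rfl⟩ : ∃ r', r = r' + 1 := ⟨r - 1, by omega⟩
  rw [lamChain_succ, lamChain_succ]
  apply lamSub_local
  intro t ht
  exact hR r (by omega) w w' hw hw' t (by omega)

lemma PA_shift' {m : ℕ} {n : ℕ → ℕ} (h : PA m (shift n)) (hn : 1 ≤ n 0) : PA (m + 1) n := by
  obtain ⟨R, hR⟩ := h
  refine ⟨R + 1, fun r hr w w' hw hw' s hs => ?_⟩
  obtain ⟨r, rfl⟩ : ∃ r', r = r' + 1 := ⟨r - 1, by omega⟩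
  rw [lamChain_succ, lamChain_succ]
  have h1 := lamChain_head (shift n) r w hw
  have h2 := lamChain_head (shift n) r w' hw'
  rw [lam2 _ h1, lam2 _ h2]
  cases s with
  | zero => rfl
  | succ s =>
    simp only [consS_succ]
    rw [appS_apply, appS_apply]
    split_ifs with hlt
    · rfl
    · simp only [List.length_replicate] at hlt ⊢
      apply lamSub_local
      intro t ht
      exact hR r (by omega) w w' hw hw' (t + 1) (by omega)

lemma PA_of {m : ℕ} (hm : ∀ n, H n → PA m n) : ∀ (r : ℕ) (n : ℕ → ℕ), H n → n r = 1 →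
    PA (m + 1) n := by
  intro r
  induction r with
  | zero => intro n hn h1; exact PA_shift' (hm _ (H_shift hn)) (by omega)
  | succ r ih => intro n hn h1; exact PA_shift (ih _ (H_shift hn) h1)

lemma PA_all (m : ℕ) : ∀ n, H n → PA m n := by
  induction m with
  | zero => intro n _; exact ⟨0, by intros; omega⟩
  | succ m ih =>
    intro n hn
    obtain ⟨r, -, h1, -⟩ := hn 0
    exact PA_of ih r n hn h1

lemma chain_stable {n : ℕ → ℕ} (hn : H n) (m : ℕ) : ∃ R, ∀ r, R ≤ r → ∀ s, s < m →
    lamChain 3 n r (topSeq 3) s = lamChain 3 n R (topSeq 3) s := by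
  obtain ⟨R, hR⟩ := PA_all m n hn
  refine ⟨R, fun r hr s hs => ?_⟩
  induction r, hr using Nat.le_induction with
  | base => rfl
  | succ r hr ih =>
    rw [← ih]
    change lamChain 3 n r (lamSub 3 (n (r + 1)) (topSeq 3)) s = _
    exact hR r hr _ _ (by rw [lam2 _ rfl]; rfl) rfl s hs

lemma S_eventually {n : ℕ → ℕ} (hn : H n) (m : ℕ) : ∃ R, ∀ r, R ≤ r → ∀ s, s < m →
    Sseq 3 n s = lamChain 3 n r (topSeq 3) s := by
  choose R hR using chain_stable hn
  have hlim : Tendsto (fun r => lamChain 3 n r (topSeq 3)) atTop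
      (𝓝 (fun s => lamChain 3 n (R (s + 1)) (topSeq 3) s)) := by
    rw [tendsto_pi_nhds]
    intro s
    apply tendsto_const_nhds.congr'
    filter_upwards [eventually_ge_atTop (R (s + 1))] with r hr
    exact (hR (s + 1) r hr s (by omega)).symm
  have hS : Sseq 3 n = fun s => lamChain 3 n (R (s + 1)) (topSeq 3) s := hlim.limUnder_eq
  refine ⟨R m, fun r hr s hs => ?_⟩
  rw [hS]
  dsimp only
  rw [hR m r hr s hs]
  rw [← hR m (max (R m) (R (s + 1))) (le_max_left _ _) s hs,
    hR (s + 1) (max (R m) (R (s + 1))) (le_max_right _ _) s (by omega)]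

lemma S_rec {n : ℕ → ℕ} (hn : H n) : Sseq 3 n = lamSub 3 (n 0) (Sseq 3 (shift n)) := by
  funext s
  obtain ⟨R, hR⟩ := S_eventually hn (s + 1)
  obtain ⟨R', hR'⟩ := S_eventually (H_shift hn) (s + 1)
  rw [hR (max R R' + 1) (by omega) s (by omega), lamChain_succ]
  apply lamSub_local
  intro t ht
  exact (hR' (max R R') (by omega) t (by omega)).symm

lemma S_zero {n : ℕ → ℕ} (hn : H n) : Sseq 3 n 0 = 2 := by
  obtain ⟨R, hR⟩ := S_eventually hn 1
  rw [hR R le_rfl 0 (by omega), lamChain_head _ _ _ rfl]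

lemma S_sigma {n : ℕ → ℕ} (hn : H n) : InSigma 3 (Sseq 3 n) := by
  rw [S_rec hn]; exact lamSub_lt _ _

lemma S_max_aux (m : ℕ) (ih : ∀ j < m, ∀ n, H n → seqLe (shift^[j] (Sseq 3 n)) (Sseq 3 n))
    (hm : 0 < m) : ∀ (s : ℕ) (n : ℕ → ℕ), H n → 1 ≤ n s →
    seqLe (shift^[m] (Sseq 3 n)) (Sseq 3 n) := by
  intro s
  induction s with
  | zero =>
    intro n hn h1
    rw [S_rec hn]
    have hs := H_shift hn
    rcases lam_decomp (n 0) m _ (S_sigma hs) with h | ⟨j, hj, h, h'⟩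
    · left; apply seqLt_of_head; rw [← S_rec hn, S_zero hn, S_rec hn]; exact h
    · rw [h]
      exact lamSub_seqLe _ (InSigma_iter (S_sigma hs) j) (S_sigma hs)
        (ih j (h' hm h1 (by rw [S_zero hs]; omega)) _ hs)
  | succ s ihs =>
    intro n hn h1
    rw [S_rec hn]
    have hs := H_shift hn
    rcases lam_decomp (n 0) m _ (S_sigma hs) with h | ⟨j, hj, h, h'⟩
    · left; apply seqLt_of_head; rw [← S_rec hn, S_zero hn, S_rec hn]; exact h
    · rw [h]
      apply lamSub_seqLe _ (InSigma_iter (S_sigma hs) j) (S_sigma hs)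
      rcases hj.lt_or_eq with hj | rfl
      · exact ih j hj _ hs
      · exact ihs _ hs h1

lemma S_max {n : ℕ → ℕ} (hn : H n) (m : ℕ) : seqLe (shift^[m] (Sseq 3 n)) (Sseq 3 n) := by
  induction m using Nat.strong_induction_on generalizing n with
  | _ m ih =>
    rcases Nat.eq_zero_or_pos m with rfl | hm
    · exact Or.inr rfl
    · obtain ⟨r, -, h1, -⟩ := hn 0
      exact S_max_aux m (fun j hj n hn => ih j hj hn) hm r n hn (by omega)

lemma S_mem_X {n : ℕ → ℕ} (hn : H n) : Sseq 3 n ∈ Xset 3 (Sseq 3 n) :=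
  ⟨S_sigma hn, S_max hn⟩

/-! ### Linear functionals, finite words and desubstitution -/

/-- Value of a linear functional on a digit. -/
def val (h : Fin 3 → ℝ) (d : ℕ) : ℝ := if d = 0 then h 0 else if d = 1 then h 1 else h 2

@[simp] lemma val_zero (h : Fin 3 → ℝ) : val h 0 = h 0 := by simp [val]
@[simp] lemma val_one (h : Fin 3 → ℝ) : val h 1 = h 1 := by simp [val]
@[simp] lemma val_two (h : Fin 3 → ℝ) : val h 2 = h 2 := by simp [val]

/-- Sum of a functional over a finite word. -/
noncomputable def lsum (h : Fin 3 → ℝ) : List ℕ → ℝ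
  | [] => 0
  | d :: p => val h d + lsum h p

@[simp] lemma lsum_nil (h : Fin 3 → ℝ) : lsum h [] = 0 := rfl
@[simp] lemma lsum_cons (h : Fin 3 → ℝ) (d : ℕ) (p : List ℕ) :
    lsum h (d :: p) = val h d + lsum h p := rfl

lemma lsum_append (h : Fin 3 → ℝ) (p q : List ℕ) : lsum h (p ++ q) = lsum h p + lsum h q := by
  induction p with
  | nil => simp
  | cons a p ih => simp [ih, add_assoc]

lemma lsum_replicate (h : Fin 3 → ℝ) (m : ℕ) : lsum h (List.replicate m 0) = m * h 0 := by
  induction m with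
  | zero => simp
  | succ m ih => rw [List.replicate_succ, lsum_cons, ih]; push_cast; simp; ring

/-- Transpose of the substitution matrix. -/
noncomputable def Mt (m : ℕ) (f : Fin 3 → ℝ) : Fin 3 → ℝ :=
  ![f 1, (m + 1) * f 0 + f 2, m * f 0 + f 2]
noncomputable def Nt (m : ℕ) (f : Fin 3 → ℝ) : Fin 3 → ℝ :=
  ![f 1 - f 2, f 0, (m + 1) * f 2 - m * f 1]

lemma Mt_Nt (m : ℕ) (f : Fin 3 → ℝ) : Mt m (Nt m f) = f := by
  funext i; fin_cases i <;> simp [Mt, Nt] <;> ring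

lemma lsum_word (n : ℕ) (h : Fin 3 → ℝ) {d : ℕ} (hd : d < 3) :
    lsum h (lamWord 3 n d) = val (Mt n h) d := by
  rcases (by omega : d = 0 ∨ d = 1 ∨ d = 2) with rfl | rfl | rfl
  · rw [lamWord_zero]; simp [Mt]
  · rw [lamWord_one, lsum_cons, lsum_replicate]; simp [Mt]; ring
  · rw [lamWord_two, lsum_cons, lsum_replicate]; simp [Mt]; ring

/-- Comparison of a finite word with a sequence. -/
def leW : List ℕ → Seq → Prop
  | [], _ => True
  | a :: p, w => a < w 0 ∨ (a = w 0 ∧ leW p (shift w))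

/-- All suffixes of the word are at most `w`. -/
def Adm (w : Seq) : List ℕ → Prop
  | [] => True
  | a :: p => leW (a :: p) w ∧ Adm w p

def Lle : List ℕ → List ℕ → Prop
  | [], _ => True
  | _ :: _, [] => False
  | a :: p, c :: q => a < c ∨ (a = c ∧ Lle p q)

lemma Lle_leW {p q : List ℕ} {w : Seq} (h : Lle p q) (h' : leW q w) : leW p w := by
  induction p generalizing q w with
  | nil => trivial
  | cons a p ih =>
    cases q with
    | nil => exact h.elim
    | cons c q =>
      simp only [Lle, leW] at h h' ⊢
      rcases h with h | ⟨h, h2⟩ <;> rcases h' with h' | ⟨h', h2'⟩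
      · left; omega
      · left; omega
      · left; omega
      · right; exact ⟨by omega, ih h2 h2'⟩

lemma Lle_app {l p q : List ℕ} (h : Lle p q) : Lle (l ++ p) (l ++ q) := by
  induction l with
  | nil => exact h
  | cons a l ih => exact Or.inr ⟨rfl, ih⟩

/-- Desubstitution: process the word from the right keeping a bank of zeros. -/
def desub (n : ℕ) : List ℕ → ℕ × List ℕ
  | [] => (0, [])
  | d :: p =>
    if d = 0 then ((desub n p).1 + 1, (desub n p).2)
    else if d = 1 then ((desub n p).1, 0 :: (desub n p).2)
    else if n + 1 ≤ (desub n p).1 then ((desub n p).1 - (n + 1), 1 :: (desub n p).2)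
    else ((desub n p).1 - n, 2 :: (desub n p).2)

def LamL (n : ℕ) : List ℕ → List ℕ
  | [] => []
  | d :: p => lamWord 3 n d ++ LamL n p

lemma desub0 (n : ℕ) (p : List ℕ) : desub n (0 :: p) = ((desub n p).1 + 1, (desub n p).2) := by
  simp [desub]
lemma desub1 (n : ℕ) (p : List ℕ) : desub n (1 :: p) = ((desub n p).1, 0 :: (desub n p).2) := by
  simp [desub]
lemma desub2 (n : ℕ) (p : List ℕ) (h : n + 1 ≤ (desub n p).1) :
    desub n (2 :: p) = ((desub n p).1 - (n + 1), 1 :: (desub n p).2) := by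
  simp [desub]; omega
lemma desub2' (n : ℕ) (p : List ℕ) (h : (desub n p).1 = n) :
    desub n (2 :: p) = (0, 2 :: (desub n p).2) := by
  simp [desub, h]

lemma desub_repl (n m : ℕ) (p : List ℕ) :
    desub n (List.replicate m 0 ++ p) = ((desub n p).1 + m, (desub n p).2) := by
  induction m with
  | zero => simp
  | succ m ih => rw [List.replicate_succ, List.cons_append, desub0, ih]; simp; omega

lemma bank_ge_aux (m : ℕ) (n : ℕ) (w : Seq) : ∀ q : List ℕ, m ≤ q.length →
    leW q (appS (List.replicate m 0) w) → m ≤ (desub n q).1 := by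
  induction m with
  | zero => intros; omega
  | succ m ih =>
    intro q hq h
    cases q with
    | nil => simp at hq
    | cons a q =>
      simp only [leW, List.replicate_succ, appS_cons, consS_zero, shift_consS] at h
      rcases h with h | ⟨rfl, h⟩
      · omega
      · have := ih q (by simpa using hq) h
        rw [desub0]; simp; omega

/-- The main induction for desubstitution. -/
lemma desub_main (n : ℕ) {w' : Seq} (hw0 : w' 0 = 2) :
    ∀ p : List ℕ, (∀ d ∈ p, d < 3) →
      Adm (lamSub 3 n w') (p ++ List.replicate (n + 1) 0) →
      let q := p ++ List.replicate (n + 1) 0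
      Lle (List.replicate (desub n q).1 0 ++ LamL n (desub n q).2) q ∧
      (∀ f : Fin 3 → ℝ, lsum f q = f 0 * (desub n q).1 + lsum (Mt n f) (desub n q).2) ∧
      ((desub n q).2 = [] → n + 1 ≤ (desub n q).1) ∧ (desub n q).2.getLast? ≠ some 2 ∧
      (∀ d ∈ (desub n q).2, d < 3) := by
  intro p
  induction p with
  | nil =>
    intro _ _
    have h := desub_repl n (n + 1) []
    simp only [List.append_nil] at h
    simp only [List.nil_append, h, desub]
    refine ⟨?_, ?_, by simp, by simp, by simp⟩
    · simp only [LamL, zero_add]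
      have := @Lle_app (List.replicate (n + 1) 0) [] [] trivial
      simpa using this
    · intro f
      rw [lsum_replicate]; simp; ring
  | cons a p ih =>
    intro hd hadm
    have ha : a < 3 := hd a (by simp)
    have hadm' : Adm (lamSub 3 n w') (p ++ List.replicate (n + 1) 0) := hadm.2
    have hle : leW (a :: (p ++ List.replicate (n + 1) 0)) (lamSub 3 n w') := hadm.1
    have IH := ih (fun d hd' => hd d (by simp [hd'])) hadm'
    simp only [List.cons_append]
    simp only at IH
    have hlen : n ≤ (p ++ List.replicate (n + 1) 0).length := by simp; omega
    generalize p ++ List.replicate (n + 1) 0 = q at *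
    obtain ⟨h1, h2, h3, h4, h5⟩ := IH
    rcases (by omega : a = 0 ∨ a = 1 ∨ a = 2) with rfl | rfl | rfl
    · rw [desub0]
      refine ⟨?_, ?_, ?_, h4, h5⟩
      · exact Or.inr ⟨rfl, h1⟩
      · intro f; rw [lsum_cons, h2]; simp; ring
      · intro h; have := h3 h; simp; omega
    · rw [desub1]
      refine ⟨?_, ?_, by simp, ?_, ?_⟩
      · simp only [LamL, lamWord_zero]
        rcases hb : (desub n q).1 with _ | b
        · rw [hb] at h1; exact Or.inr ⟨rfl, h1⟩
        · exact Or.inl (by omega)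
      · intro f; rw [lsum_cons, h2]; simp [Mt]; ring
      · rcases ho : (desub n q).2 with _ | ⟨c, o⟩
        · simp
        · rw [List.getLast?_cons_cons, ← ho]; exact h4
      · intro d hd; simp at hd; rcases hd with rfl | hd
        · omega
        · exact h5 d hd
    · have hbank : n ≤ (desub n q).1 := by
        rw [lam2 n hw0] at hle
        simp only [leW, consS_zero, lt_irrefl, true_and, false_or, shift_consS] at hle
        exact bank_ge_aux n n _ q hlen hle
      rcases Nat.lt_or_ge n (desub n q).1 with hb | hb
      · rw [desub2 n q hb]
        refine ⟨?_, ?_, by simp, ?_, ?_⟩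
        · simp only [LamL, lamWord_one]
          rcases hb' : (desub n q).1 - (n + 1) with _ | b
          · have : (desub n q).1 = n + 1 := by omega
            rw [this] at h1
            exact Or.inr ⟨rfl, h1⟩
          · exact Or.inl (by omega)
        · intro f; rw [lsum_cons, h2]; simp only [lsum_cons, val_one, val_two]
          rw [Nat.cast_sub hb]; simp [Mt]; ring
        · rcases ho : (desub n q).2 with _ | ⟨c, o⟩
          · simp
          · rw [List.getLast?_cons_cons, ← ho]; exact h4
        · intro d hd; simp at hd; rcases hd with rfl | hd
          · omega
          · exact h5 d hd
      · have hb' : (desub n q).1 = n := by omega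
        rw [desub2' n q hb']
        refine ⟨?_, ?_, by simp, ?_, ?_⟩
        · simp only [LamL, lamWord_two]
          rw [hb'] at h1
          exact Or.inr ⟨rfl, h1⟩
        · intro f; rw [lsum_cons, h2, hb']; simp [Mt]; ring
        · rcases ho : (desub n q).2 with _ | ⟨c, o⟩
          · have := h3 ho; omega
          · rw [List.getLast?_cons_cons, ← ho]; exact h4
        · intro d hd; simp at hd; rcases hd with rfl | hd
          · omega
          · exact h5 d hd

lemma leW_app_iff (l p : List ℕ) (w : Seq) : leW (l ++ p) (appS l w) ↔ leW p w := by
  induction l with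
  | nil => rfl
  | cons a l ih => simp [leW, ih]

lemma leW_reflect (n : ℕ) : ∀ (o : List ℕ) (w' : Seq), (∀ d ∈ o, d < 3) → InSigma 3 w' →
    o.getLast? ≠ some 2 → leW (LamL n o) (lamSub 3 n w') → leW o w' := by
  intro o
  induction o with
  | nil => intros; trivial
  | cons x o ih =>
    intro w' ho hw hl h
    have hx : x < 3 := ho x (by simp)
    have hw0 := hw 0
    rcases lt_trichotomy x (w' 0) with hlt | heq | hgt
    · exact Or.inl hlt
    · refine Or.inr ⟨heq, ?_⟩
      have hl' : o.getLast? ≠ some 2 := by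
        rcases o with _ | ⟨c, o⟩
        · simp
        · rwa [List.getLast?_cons_cons] at hl
      apply ih _ (fun d hd => ho d (by simp [hd])) (InSigma_shift hw) hl'
      rw [lamSub_eq, ← heq] at h
      simp only [LamL] at h
      rwa [leW_app_iff] at h
    · exfalso
      rcases (by omega : w' 0 = 0 ∨ w' 0 = 1) with h0 | h0
      · rw [lam0 n h0] at h
        rcases (by omega : x = 1 ∨ x = 2) with rfl | rfl
        · rw [LamL, lamWord_one] at h; simp [leW] at h
        · rw [LamL, lamWord_two] at h; simp [leW] at h
      · have : x = 2 := by omega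
        subst this
        rw [lam1 n h0, LamL, lamWord_two, appS_replicate_succ', List.cons_append] at h
        simp only [leW, consS_zero, lt_irrefl, true_and, false_or, shift_consS] at h
        rw [leW_app_iff] at h
        rcases o with _ | ⟨c, o⟩
        · simp at hl
        · have hc : c < 3 := ho c (by simp)
          rcases (by omega : c = 0 ∨ c = 1 ∨ c = 2) with rfl | rfl | rfl
          · rw [LamL, lamWord_zero] at h; simp [leW] at h
          · rw [LamL, lamWord_one] at h; simp [leW] at h
          · rw [LamL, lamWord_two] at h; simp [leW] at h

lemma desub_adm (n : ℕ) {w' : Seq} (hw : InSigma 3 w') (hw0 : w' 0 = 2) :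
    ∀ p : List ℕ, (∀ d ∈ p, d < 3) →
      Adm (lamSub 3 n w') (p ++ List.replicate (n + 1) 0) →
      Adm w' (desub n (p ++ List.replicate (n + 1) 0)).2 := by
  intro p
  induction p with
  | nil =>
    intro _ _
    have h := desub_repl n (n + 1) []
    simp only [List.append_nil] at h
    rw [List.nil_append, h]; trivial
  | cons a p ih =>
    intro hd hadm
    have ha : a < 3 := hd a (by simp)
    have hm := desub_main n hw0 (a :: p) hd hadm
    have hm' := desub_main n hw0 p (fun d hd' => hd d (by simp [hd'])) hadm.2
    have hadm' : Adm (lamSub 3 n w') (p ++ List.replicate (n + 1) 0) := hadm.2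
    have hle : leW (a :: (p ++ List.replicate (n + 1) 0)) (lamSub 3 n w') := hadm.1
    have IH := ih (fun d hd' => hd d (by simp [hd'])) hadm'
    simp only [List.cons_append] at hm ⊢
    simp only at hm'
    have hlen : n ≤ (p ++ List.replicate (n + 1) 0).length := by simp; omega
    generalize p ++ List.replicate (n + 1) 0 = q at *
    rcases (by omega : a = 0 ∨ a = 1 ∨ a = 2) with rfl | rfl | rfl
    · rw [desub0]; exact IH
    · rw [desub1]; exact ⟨Or.inl (by omega), IH⟩
    · rcases Nat.lt_or_ge n (desub n q).1 with hb | hb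
      · rw [desub2 n q hb]; exact ⟨Or.inl (by omega), IH⟩
      · have hbank : n ≤ (desub n q).1 := by
          rw [lam2 n hw0] at hle
          simp only [leW, consS_zero, lt_irrefl, true_and, false_or, shift_consS] at hle
          exact bank_ge_aux n n _ q hlen hle
        have hb' : (desub n q).1 = n := by omega
        rw [desub2' n q hb'] at hm ⊢
        obtain ⟨h1, h2, h3, h4, h5⟩ := hm
        refine ⟨?_, IH⟩
        apply leW_reflect n _ _ h5 hw h4
        exact Lle_leW (by simpa using h1) hle

lemma leW_snoc (p : List ℕ) (w : Seq) (h : leW p w) : leW (p ++ [0]) w := by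
  induction p generalizing w with
  | nil => simp [leW]; omega
  | cons a p ih =>
    rcases h with h | ⟨h, h2⟩
    · exact Or.inl h
    · exact Or.inr ⟨h, ih _ h2⟩

lemma Adm_snoc (p : List ℕ) (w : Seq) (h : Adm w p) : Adm w (p ++ [0]) := by
  induction p with
  | nil => exact ⟨leW_snoc [] w trivial, trivial⟩
  | cons a p ih => exact ⟨leW_snoc (a :: p) w h.1, ih h.2⟩

lemma Adm_zeros (p : List ℕ) (w : Seq) (h : Adm w p) (m : ℕ) :
    Adm w (p ++ List.replicate m 0) := by
  induction m with
  | zero => simpa using h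
  | succ m ih => rw [List.replicate_succ', ← List.append_assoc]; exact Adm_snoc _ _ ih

/-- The functionals defining the digit frequency set. -/
noncomputable def gfun : (ℕ → ℕ) → ℕ → (Fin 3 → ℝ)
  | n, 0 => ![1, 0, -(n 0 : ℝ)]
  | n, r + 1 => Nt (n 0) (gfun (shift n) r)

lemma gfun_sign (n : ℕ → ℕ) (r : ℕ) : 0 ≤ gfun n r 0 ∧ 0 ≤ gfun n r 1 ∧ gfun n r 2 ≤ 0 := by
  induction r generalizing n with
  | zero => simp [gfun]
  | succ r ih =>
    obtain ⟨h0, h1, h2⟩ := ih (shift n)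
    simp only [gfun, Nt]
    refine ⟨?_, ?_, ?_⟩
    · simp; linarith
    · simpa using h0
    · have : (0 : ℝ) ≤ n 0 := by positivity
      simp
      nlinarith

lemma lsum_nonneg (f : Fin 3 → ℝ) (h : ∀ i, 0 ≤ f i) (p : List ℕ) : 0 ≤ lsum f p := by
  induction p with
  | nil => simp
  | cons a p ih =>
    rw [lsum_cons]
    have : 0 ≤ val f a := by unfold val; split_ifs <;> apply h
    linarith

lemma words_bound (r : ℕ) : ∀ n, H n → ∃ C : ℝ, ∀ p : List ℕ, (∀ d ∈ p, d < 3) →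
    Adm (Sseq 3 n) p → -C ≤ lsum (gfun n r) p := by
  induction r with
  | zero =>
    intro n hn
    refine ⟨n 0 + 1, fun p hp hadm => ?_⟩
    have h1 := Adm_zeros p _ hadm (n 0 + 1)
    rw [S_rec hn] at h1
    obtain ⟨-, h2, -⟩ := desub_main (n 0) (S_zero (H_shift hn)) p hp h1
    have h3 := h2 (gfun n 0)
    rw [lsum_append, lsum_replicate] at h3
    have h4 : 0 ≤ lsum (Mt (n 0) (gfun n 0)) (desub (n 0) (p ++ List.replicate (n 0 + 1) 0)).2 := by
      apply lsum_nonneg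
      intro i; fin_cases i <;> simp [Mt, gfun]
    have h5 : gfun n 0 0 = 1 := by simp [gfun]
    rw [h5] at h3
    push_cast at h3
    have : (0 : ℝ) ≤ (desub (n 0) (p ++ List.replicate (n 0 + 1) 0)).1 := by positivity
    linarith
  | succ r ih =>
    intro n hn
    obtain ⟨C, hC⟩ := ih _ (H_shift hn)
    refine ⟨C + (n 0 + 1) * gfun n (r + 1) 0, fun p hp hadm => ?_⟩
    have h1 := Adm_zeros p _ hadm (n 0 + 1)
    rw [S_rec hn] at h1
    obtain ⟨-, h2, -, -, h5⟩ := desub_main (n 0) (S_zero (H_shift hn)) p hp h1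
    have h6 := desub_adm (n 0) (S_sigma (H_shift hn)) (S_zero (H_shift hn)) p hp h1
    have h3 := h2 (gfun n (r + 1))
    rw [lsum_append, lsum_replicate] at h3
    have h4 := hC _ h5 h6
    have e : Mt (n 0) (gfun n (r + 1)) = gfun (shift n) r := Mt_Nt _ _
    rw [e] at h3
    push_cast at h3
    have := mul_nonneg (gfun_sign n (r + 1)).1
      (Nat.cast_nonneg (α := ℝ) (desub (n 0) (p ++ List.replicate (n 0 + 1) 0)).1)
    linarith

/-! ### Birkhoff sums -/

def pre (v : Seq) : ℕ → List ℕ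
  | 0 => []
  | m + 1 => v 0 :: pre (shift v) m

lemma shift_pre_aux {v w : Seq} (h : seqLe v w) (m : ℕ) : leW (pre v m) w := by
  induction m generalizing v w with
  | zero => trivial
  | succ m ih =>
    rcases (seqLe_head h).lt_or_eq with h0 | h0
    · exact Or.inl h0
    · exact Or.inr ⟨h0, ih (seqLe_shift h0 h)⟩

noncomputable def bs (h : Fin 3 → ℝ) (v : Seq) (m : ℕ) : ℝ := ∑ s ∈ Finset.range m, val h (v s)

lemma bs_zero (h : Fin 3 → ℝ) (v : Seq) : bs h v 0 = 0 := by simp [bs]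

lemma bs_succ' (h : Fin 3 → ℝ) (v : Seq) (m : ℕ) :
    bs h v (m + 1) = val h (v 0) + bs h (shift v) m := by
  unfold bs
  rw [Finset.sum_range_succ', add_comm]; rfl

lemma bs_succ (h : Fin 3 → ℝ) (v : Seq) (m : ℕ) :
    bs h v (m + 1) = bs h v m + val h (v m) := by
  unfold bs
  rw [Finset.sum_range_succ]

lemma bs_pre (h : Fin 3 → ℝ) (v : Seq) (m : ℕ) : bs h v m = lsum h (pre v m) := by
  induction m generalizing v with
  | zero => simp [bs_zero, pre]
  | succ m ih => rw [bs_succ', ih]; rfl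

lemma Adm_pre {v w : Seq} (h : ∀ r, seqLe (shift^[r] v) w) (m : ℕ) : Adm w (pre v m) := by
  induction m generalizing v with
  | zero => trivial
  | succ m ih =>
    refine ⟨shift_pre_aux (h 0) (m + 1), ih fun r => ?_⟩
    have := h (r + 1)
    rwa [Function.iterate_succ_apply] at this

lemma pre_lt {v : Seq} (h : InSigma 3 v) (m : ℕ) : ∀ d ∈ pre v m, d < 3 := by
  induction m generalizing v with
  | zero => simp [pre]
  | succ m ih =>
    intro d hd
    simp only [pre, List.mem_cons] at hd
    rcases hd with rfl | hd
    · exact h 0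
    · exact ih (InSigma_shift h) d hd

lemma X_bound {n : ℕ → ℕ} (hn : H n) (r : ℕ) : ∃ C : ℝ, ∀ v ∈ Xset 3 (Sseq 3 n), ∀ m,
    -C ≤ bs (gfun n r) v m := by
  obtain ⟨C, hC⟩ := words_bound r n hn
  refine ⟨C, fun v hv m => ?_⟩
  rw [bs_pre]
  exact hC _ (pre_lt hv.1 m) (Adm_pre hv.2 m)

noncomputable def dot (f x : Fin 3 → ℝ) : ℝ := f 0 * x 0 + f 1 * x 1 + f 2 * x 2

lemma val_ind {d i : ℕ} (hd : d < 3) (hi : i < 3) (c : ℝ) :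
    val (fun j => (if (j : ℕ) = i then 1 else 0) - c) d = (if d = i then 1 else 0) - c := by
  rcases (by omega : d = 0 ∨ d = 1 ∨ d = 2) with rfl | rfl | rfl <;> simp

lemma digitCount_eq (v : Seq) (i m : ℕ) :
    (digitCount v i m : ℝ) = ∑ s ∈ Finset.range m, if v s = i then (1 : ℝ) else 0 := by
  unfold digitCount
  rw [Finset.card_filter]
  push_cast
  rfl

lemma bs_count {v : Seq} (hv : InSigma 3 v) (h : Fin 3 → ℝ) (m : ℕ) :
    bs h v m = h 0 * digitCount v 0 m + h 1 * digitCount v 1 m + h 2 * digitCount v 2 m := by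
  rw [digitCount_eq, digitCount_eq, digitCount_eq, bs, Finset.mul_sum, Finset.mul_sum,
    Finset.mul_sum, ← Finset.sum_add_distrib, ← Finset.sum_add_distrib]
  apply Finset.sum_congr rfl
  intro s _
  have := hv s
  rcases (by omega : v s = 0 ∨ v s = 1 ∨ v s = 2) with h | h | h <;> simp [h]

lemma bs_ind {v : Seq} (hv : InSigma 3 v) {i : ℕ} (hi : i < 3) (c : ℝ) (m : ℕ) :
    bs (fun j => (if (j : ℕ) = i then 1 else 0) - c) v m = digitCount v i m - c * m := by
  rw [digitCount_eq, bs]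
  rw [Finset.sum_congr rfl (fun s _ => val_ind (hv s) hi c)]
  rw [Finset.sum_sub_distrib]
  simp; ring

lemma bs_neg (h : Fin 3 → ℝ) (v : Seq) (m : ℕ) : bs (fun j => - h j) v m = - bs h v m := by
  unfold bs
  rw [← Finset.sum_neg_distrib]
  apply Finset.sum_congr rfl
  intro s _
  unfold val; split_ifs <;> rfl

def LB (h : Fin 3 → ℝ) (v : Seq) : Prop := ∀ ε : ℝ, 0 < ε → ∃ C : ℝ, ∀ m : ℕ,
  -(ε * m + C) ≤ bs h v m

def Fr (v : Seq) (x : Fin 3 → ℝ) : Prop := ∀ h, 0 ≤ dot h x → LB h v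

lemma tendsto_of_bound {a : ℕ → ℝ} {c : ℝ} (h : ∀ ε : ℝ, 0 < ε → ∃ C : ℝ, ∀ m : ℕ,
    |a m - c * m| ≤ ε * m + C) : Tendsto (fun m => a m / m) atTop (𝓝 c) := by
  rw [Metric.tendsto_atTop]
  intro ε hε
  obtain ⟨C, hC⟩ := h (ε / 2) (by linarith)
  obtain ⟨N, hN⟩ := exists_nat_gt (|C| / (ε / 2))
  refine ⟨N + 1, fun m hm => ?_⟩
  have hm0 : (0 : ℝ) < m := by
    have : 0 < m := by omega
    exact_mod_cast this
  have hNm : (N : ℝ) < m := by exact_mod_cast (by omega : N < m)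
  rw [Real.dist_eq]
  have e : a m / m - c = (a m - c * m) / m := by field_simp
  rw [e, abs_div, abs_of_pos hm0, div_lt_iff₀ hm0]
  have h1 := hC m
  rw [div_lt_iff₀ (by linarith)] at hN
  have := le_abs_self C
  nlinarith

lemma freq_of_Fr {v : Seq} (hv : InSigma 3 v) {x : E 3} (hx : x ∈ simplex 3)
    (h : Fr v x) : HasDigitFreq 3 v x := by
  intro i hi
  apply tendsto_of_bound
  have hs := hx.2
  rw [Fin.sum_univ_three] at hs
  have hp : proj x i = x ⟨i, hi⟩ := by simp [proj, hi]
  have hd : dot (fun j => (if (j : ℕ) = i then 1 else 0) - proj x i) x = 0 := by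
    rw [hp]
    unfold dot
    interval_cases i
    · simp; linear_combination (-x 0) * hs
    · simp; linear_combination (-x 1) * hs
    · simp; linear_combination (-x 2) * hs
  intro ε hε
  obtain ⟨C1, h1⟩ := h _ hd.ge ε hε
  have hd' : dot (fun j => -((if (j : ℕ) = i then 1 else 0) - proj x i)) x = 0 := by
    have e : ∀ f : Fin 3 → ℝ, dot (fun j => - f j) x = - dot f x := by
      intro f; unfold dot; ring
    rw [e, hd, neg_zero]
  obtain ⟨C2, h2⟩ := h _ hd'.ge ε hε
  refine ⟨max C1 C2, fun m => ?_⟩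
  have h1 := h1 m
  have h2 := h2 m
  rw [bs_neg, bs_ind hv hi] at h2
  rw [bs_ind hv hi] at h1
  rw [abs_le]
  constructor <;> linarith [le_max_left C1 C2, le_max_right C1 C2]

lemma bs_tendsto {v : Seq} (hv : InSigma 3 v) {x : E 3} (h : HasDigitFreq 3 v x)
    (f : Fin 3 → ℝ) : Tendsto (fun m => bs f v m / m) atTop (𝓝 (dot f x)) := by
  have h0 := (h 0 (by omega)).const_mul (f 0)
  have h1 := (h 1 (by omega)).const_mul (f 1)
  have h2 := (h 2 (by omega)).const_mul (f 2)
  have := (h0.add h1).add h2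
  have e : dot f x = f 0 * proj x 0 + f 1 * proj x 1 + f 2 * proj x 2 := by
    simp [dot, proj]
  rw [e]
  refine this.congr fun m => ?_
  rw [bs_count hv]; ring

lemma dot_gfun_nonneg {n : ℕ → ℕ} (hn : H n) {x : E 3} (hx : x ∈ DFn 3 n) (r : ℕ) :
    0 ≤ dot (gfun n r) x := by
  obtain ⟨-, v, hv, hf⟩ := hx
  obtain ⟨C, hC⟩ := X_bound hn r
  have h1 := bs_tendsto hv.1 hf (gfun n r)
  have h2 : Tendsto (fun m : ℕ => -C / (m : ℝ)) atTop (𝓝 0) :=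
    tendsto_const_div_atTop_nhds_zero_nat _
  refine le_of_tendsto_of_tendsto' h2 h1 fun m => ?_
  exact div_le_div_of_nonneg_right (hC v hv m) (by positivity)

/-! ### Substitution and frequencies -/

noncomputable def Mv (m : ℕ) (x : Fin 3 → ℝ) : Fin 3 → ℝ :=
  ![(m + 1) * x 1 + m * x 2, x 0, x 1 + x 2]
noncomputable def Nv (m : ℕ) (x : Fin 3 → ℝ) : Fin 3 → ℝ :=
  ![x 1, x 0 - m * x 2, (m + 1) * x 2 - x 0]

lemma Mv_Nv (m : ℕ) (x : Fin 3 → ℝ) : Mv m (Nv m x) = x := by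
  funext i; fin_cases i <;> simp [Mv, Nv] <;> ring
lemma Nv_Mv (m : ℕ) (x : Fin 3 → ℝ) : Nv m (Mv m x) = x := by
  funext i; fin_cases i <;> simp [Mv, Nv] <;> ring
lemma dot_Mv (m : ℕ) (f x : Fin 3 → ℝ) : dot f (Mv m x) = dot (Mt m f) x := by
  simp [dot, Mv, Mt]; ring
lemma dot_Nv (m : ℕ) (f x : Fin 3 → ℝ) : dot f (Nv m x) = dot (Nt m f) x := by
  simp [dot, Nv, Nt]; ring
lemma dot_smul (c : ℝ) (f x : Fin 3 → ℝ) : dot f (c • x) = c * dot f x := by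
  simp [dot]; ring
lemma dot_add (f x y : Fin 3 → ℝ) : dot f (x + y) = dot f x + dot f y := by
  simp [dot]; ring

lemma bs_ge (h : Fin 3 → ℝ) (v : Seq) (m : ℕ) : -((|h 0| + |h 1| + |h 2|) * m) ≤ bs h v m := by
  induction m with
  | zero => simp [bs_zero]
  | succ m ih =>
    rw [bs_succ]
    have : -(|h 0| + |h 1| + |h 2|) ≤ val h (v m) := by
      have a0 := neg_abs_le (h 0)
      have a1 := neg_abs_le (h 1)
      have a2 := neg_abs_le (h 2)
      have b0 := abs_nonneg (h 0)
      have b1 := abs_nonneg (h 1)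
      have b2 := abs_nonneg (h 2)
      unfold val; split_ifs <;> linarith
    push_cast
    linarith

lemma bs_app (h : Fin 3 → ℝ) (l : List ℕ) (w : Seq) (m : ℕ) :
    bs h (appS l w) (l.length + m) = lsum h l + bs h w m := by
  induction l with
  | nil => simp
  | cons a l ih =>
    rw [List.length_cons, show l.length + 1 + m = (l.length + m) + 1 by omega, bs_succ']
    simp only [appS_cons, consS_zero, shift_consS, ih, lsum_cons]; ring

lemma block_bound (n : ℕ) (h : Fin 3 → ℝ) : ∃ C : ℝ, ∀ (m : ℕ) (u : Seq), InSigma 3 u →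
    ∃ r ≤ m, bs (Mt n h) u r - C ≤ bs h (lamSub 3 n u) m := by
  refine ⟨(|h 0| + |h 1| + |h 2|) * (n + 2), fun m => ?_⟩
  induction m using Nat.strong_induction_on with
  | _ m ih =>
    intro u hu
    rcases lt_or_ge m (lamWord 3 n (u 0)).length with hl | hl
    · refine ⟨0, by omega, ?_⟩
      have h1 := bs_ge h (lamSub 3 n u) m
      have h2 : m ≤ n + 2 := by
        have : (lamWord 3 n (u 0)).length ≤ n + 2 := by
          unfold lamWord; split_ifs <;> simp
        omega
      have h2' : (m : ℝ) ≤ n + 2 := by exact_mod_cast h2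
      have : (|h 0| + |h 1| + |h 2|) * m ≤ (|h 0| + |h 1| + |h 2|) * (n + 2) := by gcongr
      rw [bs_zero]; linarith
    · obtain ⟨m', rfl⟩ : ∃ m', m = (lamWord 3 n (u 0)).length + m' :=
        ⟨m - (lamWord 3 n (u 0)).length, by omega⟩
      have hp := lamWord_length_pos n (u 0)
      obtain ⟨r, hr, h1⟩ := ih m' (by omega) (shift u) (InSigma_shift hu)
      refine ⟨r + 1, by omega, ?_⟩
      rw [lamSub_eq n u, bs_app, bs_succ', lsum_word n h (hu 0)]
      linarith

lemma Fr_lam {n : ℕ} {u : Seq} {β : Fin 3 → ℝ} (hu : InSigma 3 u) (h : Fr u β) :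
    Fr (lamSub 3 n u) (Mv n β) := by
  intro f hf ε hε
  rw [dot_Mv] at hf
  obtain ⟨C, hC⟩ := h _ hf ε hε
  obtain ⟨C', hC'⟩ := block_bound n f
  refine ⟨C + C', fun m => ?_⟩
  obtain ⟨r, hr, h1⟩ := hC' m u hu
  have h2 := hC r
  have : (r : ℝ) ≤ m := by exact_mod_cast hr
  nlinarith

lemma Fr_smul {v : Seq} {x : Fin 3 → ℝ} {c : ℝ} (hc : 0 < c) (h : Fr v x) : Fr v (c • x) := by
  intro f hf
  rw [dot_smul] at hf
  exact h f (by by_contra h'; push Not at h'; nlinarith)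

/-- Iterated transpose. -/
noncomputable def mtc : (ℕ → ℕ) → ℕ → (Fin 3 → ℝ) → (Fin 3 → ℝ)
  | _, 0, h => h
  | n, r + 1, h => mtc (shift n) r (Mt (n 0) h)

lemma S_bound (r : ℕ) : ∀ (n : ℕ → ℕ) (f : Fin 3 → ℝ), H n → (∀ i, 0 ≤ mtc n r f i) →
    ∃ C : ℝ, ∀ m, -C ≤ bs f (Sseq 3 n) m := by
  induction r with
  | zero =>
    intro n f hn hf
    refine ⟨0, fun m => ?_⟩
    rw [bs_pre, neg_zero]
    exact lsum_nonneg f hf _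
  | succ r ih =>
    intro n f hn hf
    obtain ⟨C, hC⟩ := ih (shift n) _ (H_shift hn) hf
    obtain ⟨C', hC'⟩ := block_bound (n 0) f
    refine ⟨C + C', fun m => ?_⟩
    obtain ⟨r, hr, h1⟩ := hC' m _ (S_sigma (H_shift hn))
    rw [← S_rec hn] at h1
    linarith [hC r]

lemma bs_add_const (h : Fin 3 → ℝ) (c : ℝ) (v : Seq) (m : ℕ) :
    bs (fun i => h i + c) v m = bs h v m + c * m := by
  unfold bs
  have : ∀ s, val (fun i => h i + c) (v s) = val h (v s) + c := by
    intro s; unfold val; split_ifs <;> rfl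
  simp only [this, Finset.sum_add_distrib]
  simp; ring

lemma Fr_S {n : ℕ → ℕ} (hn : H n) {x : Fin 3 → ℝ} (hx1 : x 0 + x 1 + x 2 = 1)
    (hx : ∀ f, 0 < dot f x → ∃ r, ∀ i, 0 ≤ mtc n r f i) :
    Fr (Sseq 3 n) x := by
  intro f hf ε hε
  have h1 : 0 < dot (fun i => f i + ε) x := by
    have : dot (fun i => f i + ε) x = dot f x + ε * (x 0 + x 1 + x 2) := by
      unfold dot; ring
    rw [this, hx1]; linarith
  obtain ⟨r, hr⟩ := hx _ h1
  obtain ⟨C, hC⟩ := S_bound r n _ hn hr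
  refine ⟨C, fun m => ?_⟩
  have := hC m
  rw [bs_add_const] at this
  linarith

/-! ### A sequence with prescribed frequencies -/

lemma floor_step {x : ℝ} (h0 : 0 ≤ x) (h1 : x ≤ 1) (m : ℕ) :
    ⌊((m + 1 : ℕ) : ℝ) * x⌋₊ = ⌊(m : ℝ) * x⌋₊ ∨ ⌊((m + 1 : ℕ) : ℝ) * x⌋₊ = ⌊(m : ℝ) * x⌋₊ + 1 := by
  have a : ⌊(m : ℝ) * x⌋₊ ≤ ⌊((m + 1 : ℕ) : ℝ) * x⌋₊ := by
    apply Nat.floor_le_floor; push_cast; nlinarith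
  have b : ⌊((m + 1 : ℕ) : ℝ) * x⌋₊ ≤ ⌊(m : ℝ) * x + 1⌋₊ := by
    apply Nat.floor_le_floor; push_cast; nlinarith
  rw [Nat.floor_add_one (by positivity)] at b
  omega

lemma floor_close {x : ℝ} (h0 : 0 ≤ x) (m : ℕ) : |(⌊(m : ℝ) * x⌋₊ : ℝ) - m * x| ≤ 1 := by
  have h : 0 ≤ (m : ℝ) * x := by positivity
  have a := Nat.floor_le h
  have b := Nat.lt_floor_add_one ((m : ℝ) * x)
  rw [abs_le]; constructor <;> linarith

lemma floor_le_self' {x : ℝ} (h1 : x ≤ 1) (m : ℕ) : ⌊(m : ℝ) * x⌋₊ ≤ m := by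
  have : ⌊(m : ℝ) * x⌋₊ ≤ ⌊(m : ℝ)⌋₊ := by
    apply Nat.floor_le_floor
    have : (0 : ℝ) ≤ m := by positivity
    nlinarith
  simpa using this

noncomputable def stSeq (b c : ℝ) : Seq := fun i =>
  if ⌊(i : ℝ) * b⌋₊ < ⌊((i + 1 : ℕ) : ℝ) * b⌋₊ then 2
  else if ⌊((i - ⌊(i : ℝ) * b⌋₊ : ℕ) : ℝ) * c⌋₊ <
    ⌊((i - ⌊(i : ℝ) * b⌋₊ + 1 : ℕ) : ℝ) * c⌋₊ then 0 else 1

lemma stSeq_sigma (b c : ℝ) : InSigma 3 (stSeq b c) := by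
  intro i; unfold stSeq; split_ifs <;> omega

lemma stSeq_no_two (c : ℝ) (i : ℕ) : stSeq 0 c i < 2 := by
  unfold stSeq; simp; split_ifs <;> omega

lemma stSeq_bs {b c : ℝ} (hb0 : 0 ≤ b) (hb1 : b ≤ 1) (hc0 : 0 ≤ c) (hc1 : c ≤ 1)
    (h : Fin 3 → ℝ) (m : ℕ) :
    bs h (stSeq b c) m = h 2 * ⌊(m : ℝ) * b⌋₊ +
      h 0 * ⌊((m - ⌊(m : ℝ) * b⌋₊ : ℕ) : ℝ) * c⌋₊ +
      h 1 * (((m - ⌊(m : ℝ) * b⌋₊ : ℕ) : ℝ) - ⌊((m - ⌊(m : ℝ) * b⌋₊ : ℕ) : ℝ) * c⌋₊) := by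
  induction m with
  | zero => simp [bs_zero]
  | succ m ih =>
    rw [bs_succ, ih]
    have hle := floor_le_self' hb1 m
    have hs := floor_step hb0 hb1 m
    unfold stSeq
    generalize ⌊(m : ℝ) * b⌋₊ = F at *
    generalize ⌊((m + 1 : ℕ) : ℝ) * b⌋₊ = F' at *
    rcases hs with rfl | rfl
    · have e : m + 1 - F' = m - F' + 1 := by omega
      rw [if_neg (lt_irrefl _), e]
      have hs := floor_step hc0 hc1 (m - F')
      generalize m - F' = q at *
      generalize ⌊(q : ℝ) * c⌋₊ = G at *
      generalize ⌊((q + 1 : ℕ) : ℝ) * c⌋₊ = G' at *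
      rcases hs with rfl | rfl
      · rw [if_neg (lt_irrefl _)]; push_cast; simp; ring
      · rw [if_pos (by omega)]; push_cast; simp; ring
    · have e : m + 1 - (F + 1) = m - F := by omega
      rw [if_pos (by omega), e]; push_cast; simp; ring

lemma exists_freq {x : Fin 3 → ℝ} (h0 : ∀ i, 0 ≤ x i) (h1 : x 0 + x 1 + x 2 = 1) :
    ∃ u : Seq, InSigma 3 u ∧ Fr u x ∧ (x 2 = 0 → ∀ i, u i < 2) := by
  have hc0 : 0 ≤ x 0 / (x 0 + x 1) := div_nonneg (h0 0) (add_nonneg (h0 0) (h0 1))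
  have hc1 : x 0 / (x 0 + x 1) ≤ 1 :=
    div_le_one_of_le₀ (by linarith [h0 1]) (add_nonneg (h0 0) (h0 1))
  have hb1 : x 2 ≤ 1 := by linarith [h0 0, h0 1]
  have hcx : x 0 / (x 0 + x 1) * (1 - x 2) = x 0 := by
    have e : 1 - x 2 = x 0 + x 1 := by linarith
    rw [e]
    rcases eq_or_ne (x 0 + x 1) 0 with h | h
    · rw [h]; simp; linarith [h0 0, h0 1]
    · field_simp
  refine ⟨stSeq (x 2) (x 0 / (x 0 + x 1)), stSeq_sigma _ _, ?_, ?_⟩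
  · intro f hf ε hε
    refine ⟨(|f 0| + |f 1| + |f 2|) * 3, fun m => ?_⟩
    rw [stSeq_bs (h0 2) hb1 hc0 hc1]
    generalize x 0 / (x 0 + x 1) = c at *
    have e1 := floor_close (h0 2) m
    have hle := floor_le_self' hb1 m
    generalize ⌊(m : ℝ) * x 2⌋₊ = F at *
    have e2 := floor_close hc0 (m - F)
    generalize ⌊((m - F : ℕ) : ℝ) * c⌋₊ = G at *
    rw [Nat.cast_sub hle] at *
    rw [abs_le] at e1 e2
    have k2 : |(F : ℝ) - m * x 2| ≤ 3 := by rw [abs_le]; constructor <;> linarith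
    have k0 : |(G : ℝ) - m * x 0| ≤ 2 := by
      rw [abs_le]
      have : (m : ℝ) * x 0 = m * (1 - x 2) * c := by rw [← hcx]; ring
      rw [this]
      constructor <;> nlinarith
    have k1 : |(m - F - G : ℝ) - m * x 1| ≤ 3 := by
      rw [abs_le] at *
      have : (m : ℝ) * x 1 = m - m * x 0 - m * x 2 := by
        have : x 1 = 1 - x 0 - x 2 := by linarith
        rw [this]; ring
      rw [this]
      constructor <;> linarith
    have l2 := neg_abs_le (f 2 * ((F : ℝ) - m * x 2))
    have l1 := neg_abs_le (f 1 * ((m - F - G : ℝ) - m * x 1))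
    have l0 := neg_abs_le (f 0 * ((G : ℝ) - m * x 0))
    rw [abs_mul] at l0 l1 l2
    have p0 := mul_le_mul_of_nonneg_left k0 (abs_nonneg (f 0))
    have p1 := mul_le_mul_of_nonneg_left k1 (abs_nonneg (f 1))
    have p2 := mul_le_mul_of_nonneg_left k2 (abs_nonneg (f 2))
    have hm : 0 ≤ (m : ℝ) * dot f x := by positivity
    have hε' : 0 ≤ ε * m := by positivity
    unfold dot at hm
    have b0 := abs_nonneg (f 0)
    nlinarith
  · intro h; rw [h]; exact stSeq_no_two _

@[simp] lemma Mv_0 (m : ℕ) (x : Fin 3 → ℝ) : Mv m x 0 = (m + 1) * x 1 + m * x 2 := rfl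
@[simp] lemma Mv_1 (m : ℕ) (x : Fin 3 → ℝ) : Mv m x 1 = x 0 := rfl
@[simp] lemma Mv_2 (m : ℕ) (x : Fin 3 → ℝ) : Mv m x 2 = x 1 + x 2 := rfl
@[simp] lemma Nv_0 (m : ℕ) (x : Fin 3 → ℝ) : Nv m x 0 = x 1 := rfl
@[simp] lemma Nv_1 (m : ℕ) (x : Fin 3 → ℝ) : Nv m x 1 = x 0 - m * x 2 := rfl
@[simp] lemma Nv_2 (m : ℕ) (x : Fin 3 → ℝ) : Nv m x 2 = (m + 1) * x 2 - x 0 := rfl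

noncomputable def orb : (ℕ → ℕ) → ℕ → (Fin 3 → ℝ) → (Fin 3 → ℝ)
  | _, 0, x => x
  | n, r + 1, x => orb (shift n) r (Nv (n 0) x)

def nn (x : Fin 3 → ℝ) : Prop := 0 ≤ x 0 ∧ 0 ≤ x 1 ∧ 0 ≤ x 2

def Pos (n : ℕ → ℕ) (x : Fin 3 → ℝ) : Prop := ∀ r, nn (orb n r x)

def tot (x : Fin 3 → ℝ) : ℝ := x 0 + x 1 + x 2

lemma Pos.nn {n : ℕ → ℕ} {x : Fin 3 → ℝ} (h : Pos n x) : nn x := h 0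
lemma Pos.next {n : ℕ → ℕ} {x : Fin 3 → ℝ} (h : Pos n x) : Pos (shift n) (Nv (n 0) x) :=
  fun r => h (r + 1)
lemma Pos.mk {n : ℕ → ℕ} {x : Fin 3 → ℝ} (h : BetaDF.nn x) (h' : Pos (shift n) (Nv (n 0) x)) :
    Pos n x := fun r => by
  cases r with
  | zero => exact h
  | succ r => exact h' r

lemma Nv_smul (m : ℕ) (c : ℝ) (x : Fin 3 → ℝ) : Nv m (c • x) = c • Nv m x := by
  funext i; fin_cases i <;> simp [Nv] <;> ring
lemma Mv_smul (m : ℕ) (c : ℝ) (x : Fin 3 → ℝ) : Mv m (c • x) = c • Mv m x := by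
  funext i; fin_cases i <;> simp [Mv] <;> ring
lemma Nv_add (m : ℕ) (x y : Fin 3 → ℝ) : Nv m (x + y) = Nv m x + Nv m y := by
  funext i; fin_cases i <;> simp [Nv] <;> ring
lemma orb_smul (r : ℕ) (c : ℝ) : ∀ (n : ℕ → ℕ) (x : Fin 3 → ℝ),
    orb n r (c • x) = c • orb n r x := by
  induction r with
  | zero => intro n x; rfl
  | succ r ih => intro n x; simp only [orb, Nv_smul, ih]
lemma nn_smul {c : ℝ} {x : Fin 3 → ℝ} (hc : 0 ≤ c) (h : nn x) : nn (c • x) := by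
  obtain ⟨a, b, d⟩ := h
  refine ⟨?_, ?_, ?_⟩ <;> simp <;> positivity
lemma Pos.smul {n : ℕ → ℕ} {c : ℝ} {x : Fin 3 → ℝ} (hc : 0 ≤ c) (h : Pos n x) : Pos n (c • x) :=
  fun r => by rw [orb_smul]; exact nn_smul hc (h r)
lemma tot_smul (c : ℝ) (x : Fin 3 → ℝ) : tot (c • x) = c * tot x := by simp [tot]; ring
lemma nn_Mv {m : ℕ} {x : Fin 3 → ℝ} (h : nn x) : nn (Mv m x) := by
  obtain ⟨a, b, c⟩ := h
  refine ⟨?_, ?_, ?_⟩ <;> simp <;> positivity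
lemma tot_Mv_pos {m : ℕ} {x : Fin 3 → ℝ} (h : nn x) (h' : 0 < tot x) : 0 < tot (Mv m x) := by
  obtain ⟨a, b, c⟩ := h
  simp only [tot, Mv_0, Mv_1, Mv_2] at *
  have : (0:ℝ) ≤ m := by positivity
  nlinarith [mul_nonneg this b, mul_nonneg this c]
lemma tot_Nv_pos {m : ℕ} {x : Fin 3 → ℝ} (h : nn x) (hN : nn (Nv m x)) (h' : 0 < tot x) :
    0 < tot (Nv m x) := by
  obtain ⟨a, b, c⟩ := h
  obtain ⟨a', b', c'⟩ := hN
  simp only [tot, Nv_0, Nv_1, Nv_2] at *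
  have : (0:ℝ) ≤ m := by positivity
  by_contra hc
  have : x 2 = 0 := by nlinarith
  have : x 1 = 0 := by nlinarith
  simp_all
  linarith

def Q (θ : ℝ) (x y : Fin 3 → ℝ) : Prop := ∃ l u : ℝ, 0 < l ∧ nn (x - l • y) ∧ nn (u • y - x) ∧
  u ≤ (1 + θ) * l

lemma nn_Q_aux {m : ℕ} {x y : Fin 3 → ℝ} {l : ℝ} (h : nn (x - l • y)) :
    nn (Mv m x - l • Mv m y) := by
  have := nn_Mv (m := m) h
  convert this using 1
  funext i; fin_cases i <;> simp [Mv] <;> ring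
lemma nn_Q_aux' {m : ℕ} {x y : Fin 3 → ℝ} {l : ℝ} (h : nn (l • y - x)) :
    nn (l • Mv m y - Mv m x) := by
  have := nn_Mv (m := m) h
  convert this using 1
  funext i; fin_cases i <;> simp [Mv] <;> ring

lemma Q_Mv {θ : ℝ} {x y : Fin 3 → ℝ} {m : ℕ} (h : Q θ x y) : Q θ (Mv m x) (Mv m y) := by
  obtain ⟨l, u, h0, h1, h2, h3⟩ := h
  exact ⟨l, u, h0, nn_Q_aux h1, nn_Q_aux' h2, h3⟩

noncomputable def B (x : Fin 3 → ℝ) : Fin 3 → ℝ := Mv 1 (Mv 1 (Mv 1 x))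

lemma B_0 (x : Fin 3 → ℝ) : B x 0 = x 0 + 5 * x 1 + 3 * x 2 := by simp [B]; ring
lemma B_1 (x : Fin 3 → ℝ) : B x 1 = 2 * x 0 + x 1 + x 2 := by simp [B]; ring
lemma B_2 (x : Fin 3 → ℝ) : B x 2 = x 0 + 3 * x 1 + 2 * x 2 := by simp [B]; ring

lemma B_bounds {x : Fin 3 → ℝ} (h : nn x) : ∀ i, tot x ≤ B x i ∧ B x i ≤ 5 * tot x := by
  obtain ⟨a, b, c⟩ := h
  intro i
  unfold tot
  fin_cases i <;> simp [B_0, B_1, B_2] <;> constructor <;> linarith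

lemma Q_B_base {x y : Fin 3 → ℝ} (hx : nn x) (hy : nn y) (tx : 0 < tot x) (ty : 0 < tot y) :
    Q 24 (B x) (B y) := by
  have bx := B_bounds hx
  have bY := B_bounds hy
  have k1 : ∀ i, 0 ≤ B x i - tot x / (5 * tot y) * B y i := by
    intro i
    have := mul_le_mul_of_nonneg_left (bY i).2 (by positivity : 0 ≤ tot x / (5 * tot y))
    have e : tot x / (5 * tot y) * (5 * tot y) = tot x := by field_simp
    have := (bx i).1
    linarith
  have k2 : ∀ i, 0 ≤ 5 * tot x / tot y * B y i - B x i := by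
    intro i
    have := mul_le_mul_of_nonneg_left (bY i).1 (by positivity : 0 ≤ 5 * tot x / tot y)
    have e : 5 * tot x / tot y * tot y = 5 * tot x := by field_simp
    have := (bx i).2
    linarith
  refine ⟨tot x / (5 * tot y), 5 * tot x / tot y, by positivity, ⟨k1 0, k1 1, k1 2⟩,
    ⟨k2 0, k2 1, k2 2⟩, ?_⟩
  apply le_of_eq; field_simp; norm_num

lemma Q_B_step {θ : ℝ} {x y : Fin 3 → ℝ} (hθ : 0 ≤ θ) (hy : nn y) (ty : 0 < tot y)
    (h : Q θ x y) : Q (4 / 5 * θ) (B x) (B y) := by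
  obtain ⟨l, u, h0, h1, h2, h3⟩ := h
  have bY := B_bounds hy
  set U := x - l • y with hU
  set V := u • y - x with hV
  have b1 := B_bounds h1
  have b2 := B_bounds h2
  have eU : ∀ i, B U i = B x i - l * B y i := by
    intro i; fin_cases i <;> simp [B_0, B_1, B_2, hU] <;> ring
  have eV : ∀ i, B V i = u * B y i - B x i := by
    intro i; fin_cases i <;> simp [B_0, B_1, B_2, hV] <;> ring
  have tU : 0 ≤ tot U := by obtain ⟨a, b, c⟩ := h1; unfold tot; positivity
  have tV : 0 ≤ tot V := by obtain ⟨a, b, c⟩ := h2; unfold tot; positivity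
  have tUV : tot U + tot V = (u - l) * tot y := by simp [hU, hV, tot]; ring
  have k1 : ∀ i, 0 ≤ B x i - (l + tot U / (5 * tot y)) * B y i := by
    intro i
    have := mul_le_mul_of_nonneg_left (bY i).2 (by positivity : 0 ≤ tot U / (5 * tot y))
    have e : tot U / (5 * tot y) * (5 * tot y) = tot U := by field_simp
    have := (b1 i).1
    have := eU i
    linarith
  have k2 : ∀ i, 0 ≤ (u - tot V / (5 * tot y)) * B y i - B x i := by
    intro i
    have := mul_le_mul_of_nonneg_left (bY i).2 (by positivity : 0 ≤ tot V / (5 * tot y))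
    have e : tot V / (5 * tot y) * (5 * tot y) = tot V := by field_simp
    have := (b2 i).1
    have := eV i
    linarith
  refine ⟨_, _, ?_, ⟨k1 0, k1 1, k1 2⟩, ⟨k2 0, k2 1, k2 2⟩, ?_⟩
  · positivity
  · have e : tot U / (5 * tot y) + tot V / (5 * tot y) = (u - l) / 5 := by
      rw [← add_div, tUV]; field_simp
    have p : 0 ≤ tot U / (5 * tot y) := by positivity
    nlinarith [mul_nonneg hθ p]

lemma descend_aux {R : (Fin 3 → ℝ) → (Fin 3 → ℝ) → Prop}
    (h1 : ∀ m x y, nn x → nn y → R x y → R (Mv m x) (Mv m y))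
    (h2 : ∀ n x y, H n → Pos n x → Pos n y → 0 < tot x → 0 < tot y → n 0 = 1 → n 1 = 1 → n 2 = 1 →
      R x y) (r : ℕ) : ∀ n x y, H n → Pos n x → Pos n y → 0 < tot x → 0 < tot y →
      n r = 1 → n (r + 1) = 1 → n (r + 2) = 1 → R x y := by
  induction r with
  | zero => exact h2
  | succ r ih =>
    intro n x y hn hx hy tx ty a b c
    have := h1 (n 0) _ _ hx.next.nn hy.next.nn (ih (shift n) (Nv (n 0) x) (Nv (n 0) y) (H_shift hn) hx.next hy.next
      (tot_Nv_pos hx.nn hx.next.nn tx) (tot_Nv_pos hy.nn hy.next.nn ty) a b c)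
    rwa [Mv_Nv, Mv_Nv] at this

lemma descend {R : (Fin 3 → ℝ) → (Fin 3 → ℝ) → Prop}
    (h1 : ∀ m x y, nn x → nn y → R x y → R (Mv m x) (Mv m y))
    (h2 : ∀ n x y, H n → Pos n x → Pos n y → 0 < tot x → 0 < tot y →
      R (B x) (B y)) (n : ℕ → ℕ) (x y : Fin 3 → ℝ) (hn : H n) (hx : Pos n x) (hy : Pos n y)
      (tx : 0 < tot x) (ty : 0 < tot y) : R x y := by
  obtain ⟨r, -, a, b, c, -⟩ := hn 0
  refine descend_aux h1 ?_ r n x y hn hx hy tx ty a b c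
  intro n x y hn hx hy tx ty a b c
  have e : ∀ x, Nv (shift (shift n) 0) (Nv (shift n 0) (Nv (n 0) x)) = Nv 1 (Nv 1 (Nv 1 x)) := by
    intro x; simp [shift, a, b, c]
  have tt : ∀ x, Pos n x → 0 < tot x → 0 < tot (Nv 1 (Nv 1 (Nv 1 x))) := by
    intro x hx tx
    rw [← e]
    exact tot_Nv_pos hx.next.next.nn hx.next.next.next.nn (tot_Nv_pos hx.next.nn hx.next.next.nn
      (tot_Nv_pos hx.nn hx.next.nn tx))
  have := h2 _ _ _ (H_shift (H_shift (H_shift hn))) (e x ▸ hx.next.next.next)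
    (e y ▸ hy.next.next.next) (tt x hx tx) (tt y hy ty)
  simpa only [B, Mv_Nv] using this

lemma Q_all (k : ℕ) : ∀ (n : ℕ → ℕ) (x y : Fin 3 → ℝ) (_ : H n) (_ : Pos n x) (_ : Pos n y)
      (_ : 0 < tot x) (_ : 0 < tot y), Q ((4 / 5) ^ k * 24) x y := by
  induction k with
  | zero =>
    refine descend (fun m x y _ _ => Q_Mv) ?_
    intro n x y _ hx hy tx ty
    simpa using Q_B_base hx.nn hy.nn tx ty
  | succ k ih =>
    refine descend (fun m x y _ _ => Q_Mv) ?_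
    intro n x y hn hx hy tx ty
    rw [pow_succ', mul_assoc]
    exact Q_B_step (by positivity) hy.nn ty (ih n x y hn hx hy tx ty)

lemma Pos_le {n : ℕ → ℕ} {x y : Fin 3 → ℝ} (hn : H n) (hx : Pos n x) (hy : Pos n y)
    (tx : tot x = 1) (ty : tot y = 1) (i : Fin 3) : x i ≤ y i := by
  have h : ∀ k : ℕ, x i ≤ y i + (4 / 5) ^ k * 24 := by
    intro k
    obtain ⟨l, u, h0, ⟨a0, a1, a2⟩, ⟨b0, b1, b2⟩, h3⟩ := Q_all k n x y hn hx hy (by linarith) (by linarith)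
    obtain ⟨y0, y1, y2⟩ := hy.nn
    simp at a0 a1 a2 b0 b1 b2
    have hl : l ≤ 1 := by unfold tot at *; nlinarith
    have hp : (0:ℝ) < (4 / 5) ^ k := by positivity
    have hu : u ≤ 1 + (4 / 5) ^ k * 24 := by nlinarith
    unfold tot at ty
    fin_cases i <;> simp <;> nlinarith
  have h2 : Tendsto (fun k : ℕ => y i + (4 / 5 : ℝ) ^ k * 24) atTop (𝓝 (y i + 0 * 24)) :=
    ((tendsto_pow_atTop_nhds_zero_of_lt_one (by norm_num) (by norm_num)).mul_const _).const_add _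
  have := ge_of_tendsto' h2 h
  linarith

lemma Pos_unique {n : ℕ → ℕ} {x y : Fin 3 → ℝ} (hn : H n) (hx : Pos n x) (hy : Pos n y)
    (tx : tot x = 1) (ty : tot y = 1) : x = y :=
  funext fun i => le_antisymm (Pos_le hn hx hy tx ty i) (Pos_le hn hy hx ty tx i)

def sp (x : Fin 3 → ℝ) : Prop := 0 < x 0 ∧ 0 < x 1 ∧ 0 < x 2

lemma Pos_sp {n : ℕ → ℕ} {x : Fin 3 → ℝ} (hn : H n) (hx : Pos n x) (tx : 0 < tot x) : sp x := by
  refine descend (R := fun x _ => sp x) ?_ ?_ n x x hn hx hx tx tx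
  · rintro m x - - - ⟨a, b, c⟩
    refine ⟨?_, ?_, ?_⟩ <;> simp <;> positivity
  · intro n x _ _ hx _ tx _
    have := B_bounds hx.nn
    exact ⟨lt_of_lt_of_le tx (this 0).1, lt_of_lt_of_le tx (this 1).1, lt_of_lt_of_le tx (this 2).1⟩

lemma Nv_cont (m : ℕ) : Continuous (Nv m) := by
  unfold Nv
  refine continuous_pi fun i => ?_
  fin_cases i <;> simp <;> fun_prop

lemma orb_cont (r : ℕ) : ∀ n, Continuous (orb n r) := by
  induction r with
  | zero => intro n; exact continuous_id
  | succ r ih => intro n; exact (ih (shift n)).comp (Nv_cont (n 0))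

lemma closed_nn : IsClosed {x : Fin 3 → ℝ | nn x} := by
  unfold nn
  refine IsClosed.inter ?_ (IsClosed.inter ?_ ?_) <;>
  exact isClosed_le continuous_const (continuous_apply _)

lemma tot_cont : Continuous tot := by unfold tot; fun_prop

lemma compact_ex {n : ℕ → ℕ} {P : (Fin 3 → ℝ) → Prop} (hP : IsClosed {x | P x})
    (hne : ∀ r, ∃ x, tot x = 1 ∧ (∀ s ≤ r, nn (orb n s x)) ∧ P x) :
    ∃ x, tot x = 1 ∧ Pos n x ∧ P x := by
  let C : ℕ → Set (Fin 3 → ℝ) := fun r => {x | tot x = 1} ∩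
    ((⋂ s ≤ r, {x | nn (orb n s x)}) ∩ {x | P x})
  have hcl : ∀ r, IsClosed (C r) := by
    intro r
    refine IsClosed.inter (isClosed_eq tot_cont continuous_const) (IsClosed.inter ?_ hP)
    exact isClosed_iInter fun s => isClosed_iInter fun _ => closed_nn.preimage (orb_cont s n)
  have hne' : (⋂ r, C r).Nonempty := by
    refine IsCompact.nonempty_iInter_of_sequence_nonempty_isCompact_isClosed C ?_ ?_ ?_ hcl
    · intro r x hx
      refine ⟨hx.1, ?_, hx.2.2⟩
      have := hx.2.1
      simp only [Set.mem_iInter] at this ⊢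
      intro s hs
      exact this s (by omega)
    · intro r
      obtain ⟨x, a, b, c⟩ := hne r
      refine ⟨x, a, ?_, c⟩
      simpa using b
    · refine IsCompact.of_isClosed_subset (isCompact_Icc (a := (0 : Fin 3 → ℝ)) (b := 1)) (hcl 0) ?_
      rintro x ⟨a, b, -⟩
      simp at b
      obtain ⟨b0, b1, b2⟩ := b
      simp only [orb] at b0 b1 b2
      simp only [tot, Set.mem_setOf_eq] at a
      constructor
      · intro i; fin_cases i <;> simpa
      · intro i; fin_cases i <;> simp <;> linarith
  obtain ⟨x, hx⟩ := hne'
  simp only [Set.mem_iInter] at hx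
  refine ⟨x, (hx 0).1, fun r => ?_, (hx 0).2.2⟩
  have := (hx r).2.1
  simp only [Set.mem_iInter] at this
  exact this r le_rfl

lemma pull_ex (r : ℕ) : ∀ (n : ℕ → ℕ) (y : Fin 3 → ℝ), nn y → 0 < tot y → 
    ∃ x, 0 < tot x ∧ (∀ s ≤ r, nn (orb n s x)) ∧ orb n r x = y := by
  induction r with
  | zero =>
    intro n y hy ty
    exact ⟨y, ty, by simpa [orb] using hy, rfl⟩
  | succ r ih =>
    intro n y hy ty
    obtain ⟨x, tx, a, b⟩ := ih (shift n) y hy ty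
    refine ⟨Mv (n 0) x, tot_Mv_pos (a 0 (by omega)) tx, ?_, ?_⟩
    · intro s hs
      cases s with
      | zero => exact nn_Mv (a 0 (by omega))
      | succ s => simp only [orb, Nv_Mv]; exact a s (by omega)
    · simp only [orb, Nv_Mv]; exact b

lemma dot_orb (r : ℕ) : ∀ (n : ℕ → ℕ) (f x : Fin 3 → ℝ), dot (mtc n r f) (orb n r x) = dot f x := by
  induction r with
  | zero => intros; rfl
  | succ r ih =>
    intro n f x
    simp only [mtc, orb]
    rw [ih, ← dot_Mv, Mv_Nv]

lemma pull_ex1 (r : ℕ) (n : ℕ → ℕ) (y : Fin 3 → ℝ) (hy : nn y) (ty : 0 < tot y) :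
    ∃ x, tot x = 1 ∧ (∀ s ≤ r, nn (orb n s x)) ∧ ∃ c : ℝ, 0 < c ∧ orb n r x = c • y := by
  obtain ⟨x, tx, a, b⟩ := pull_ex r n y hy ty
  refine ⟨(tot x)⁻¹ • x, ?_, ?_, (tot x)⁻¹, by positivity, ?_⟩
  · rw [tot_smul]; field_simp
  · intro s hs; rw [orb_smul]; exact nn_smul (by positivity) (a s hs)
  · rw [orb_smul, b]

lemma ex_alpha (n : ℕ → ℕ) : ∃ x, tot x = 1 ∧ Pos n x := by
  obtain ⟨x, a, b, -⟩ := compact_ex (n := n) (P := fun _ => True) (by simp) (fun r => by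
    obtain ⟨x, a, b, -⟩ := pull_ex1 r n 1 (by simp [nn]) (by simp [tot]; norm_num)
    exact ⟨x, a, b, trivial⟩)
  exact ⟨x, a, b⟩

lemma dot_cont (f : Fin 3 → ℝ) : Continuous (dot f) := by unfold dot; fun_prop

lemma mtc_eventually {n : ℕ → ℕ} (hn : H n) {x : Fin 3 → ℝ} (hx : Pos n x) (tx : tot x = 1)
    (f : Fin 3 → ℝ) (hf : 0 < dot f x) : ∃ r, ∀ i, 0 ≤ mtc n r f i := by
  by_contra hc
  push Not at hc
  obtain ⟨y, a, b, c⟩ := compact_ex (n := n) (P := fun y => dot f y ≤ 0)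
    (isClosed_le (dot_cont f) continuous_const) (fun r => by
      obtain ⟨i, hi⟩ := hc r
      obtain ⟨x, a, b, c, hc, e⟩ := pull_ex1 r n (Pi.single i 1) (by fin_cases i <;> simp [nn])
        (by fin_cases i <;> simp [tot])
      refine ⟨x, a, b, ?_⟩
      rw [← dot_orb r n, e, dot_smul]
      have : dot (mtc n r f) (Pi.single i 1) = mtc n r f i := by
        fin_cases i <;> simp [dot]
      rw [this]
      nlinarith)
  rw [Pos_unique hn b hx a tx] at c
  linarith

lemma mem_simplex {x : E 3} : x ∈ simplex 3 ↔ nn x ∧ tot x = 1 := by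
  unfold simplex nn tot
  simp [Fin.forall_fin_succ, Fin.sum_univ_three]

lemma mem_simplex' {x : E 3} : x ∈ simplex' 3 ↔ nn x ∧ tot x = 1 ∧ 0 < x 2 := by
  unfold simplex' faceF
  simp only [Set.mem_diff, mem_simplex, Set.mem_setOf_eq, not_and]
  have : proj x 2 = x 2 := by simp [proj]; 
  rw [this]
  constructor
  · rintro ⟨⟨a, b⟩, c⟩
    exact ⟨a, b, lt_of_le_of_ne a.2.2 (Ne.symm (c ⟨a, b⟩))⟩
  · rintro ⟨a, b, c⟩
    exact ⟨⟨a, b⟩, fun _ => c.ne'⟩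

lemma Kstep_eq (x : E 3) : (Kstep x : Fin 3 → ℝ) = (1 - x 0)⁻¹ • Nv (Jfun x) x := by
  funext i
  fin_cases i <;> simp [Kstep, Kmap, proj] <;> ring

lemma Jfun_eq (x : E 3) : Jfun x = ⌊x 0 / x 2⌋₊ := by simp [Jfun, proj]

lemma Phi_Kstep (x : E 3) : Phi (Kstep x) = shift (Phi x) := by
  funext r; rfl

lemma Kstep_mem {x : E 3} (hx : x ∈ simplex' 3) : 0 < 1 - x 0 ∧ Kstep x ∈ simplex' 3 := by
  obtain ⟨⟨a, b, c⟩, t, p⟩ := mem_simplex'.1 hx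
  unfold tot at t
  have h0 : 0 < 1 - x 0 := by linarith
  have j1 := Nat.floor_le (div_nonneg a c)
  have j2 := Nat.lt_floor_add_one (x 0 / x 2)
  rw [← Jfun_eq] at j1 j2
  rw [le_div_iff₀ p] at j1
  rw [div_lt_iff₀ p] at j2
  refine ⟨h0, mem_simplex'.2 ?_⟩
  rw [Kstep_eq]
  have hi : 0 < (1 - x 0)⁻¹ := by positivity
  refine ⟨nn_smul hi.le ⟨?_, ?_, ?_⟩, ?_, ?_⟩
  · simpa using b
  · simp; linarith
  · simp; linarith
  · rw [tot_smul, inv_mul_eq_one₀ h0.ne']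
    simp [tot]; linarith
  · simp only [Pi.smul_apply, smul_eq_mul, Nv_2]
    apply mul_pos hi; linarith

lemma Phi_Pos (r : ℕ) : ∀ {x : E 3}, x ∈ simplex' 3 → nn (orb (Phi x) r x) := by
  induction r with
  | zero => intro x hx; exact (mem_simplex'.1 hx).1
  | succ r ih =>
    intro x hx
    obtain ⟨h0, h1⟩ := Kstep_mem hx
    have := ih h1
    rw [Phi_Kstep, Kstep_eq, orb_smul] at this
    have := nn_smul h0.le this
    rw [smul_smul, mul_inv_cancel₀ h0.ne', one_smul] at this
    exact this

lemma Pos_Phi (r : ℕ) : ∀ {n : ℕ → ℕ} {x : E 3}, H n → Pos n x → tot x = 1 → Phi x r = n r := by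
  have key : ∀ {n : ℕ → ℕ} {x : E 3}, H n → Pos n x → tot x = 1 → Jfun x = n 0 ∧ x ∈ simplex' 3 := by
    intro n x hn hx tx
    have h1 := Pos_sp hn hx (by linarith)
    have h2 := Pos_sp (H_shift hn) hx.next (tot_Nv_pos hx.nn hx.next.nn (by linarith))
    obtain ⟨a, b, c⟩ := h1
    obtain ⟨a', b', c'⟩ := h2
    simp at a' b' c'
    refine ⟨?_, mem_simplex'.2 ⟨hx.nn, tx, c⟩⟩
    rw [Jfun_eq, Nat.floor_eq_iff (by positivity)]
    rw [le_div_iff₀ c, div_lt_iff₀ c]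
    constructor <;> linarith
  induction r with
  | zero => intro n x hn hx tx; exact (key hn hx tx).1
  | succ r ih =>
    intro n x hn hx tx
    obtain ⟨k1, k2⟩ := key hn hx tx
    obtain ⟨h0, h1⟩ := Kstep_mem k2
    have := ih (n := shift n) (x := Kstep x) (H_shift hn) ?_ (mem_simplex'.1 h1).2.1
    · rw [Phi_Kstep] at this; exact this
    · rw [Kstep_eq, k1]; exact hx.next.smul (by positivity)

lemma PhiFiber_eq {n : ℕ → ℕ} (hn : H n) {x : E 3} (hx : Pos n x) (tx : tot x = 1) :
    PhiFiber 3 n = {x} := by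
  ext y
  simp only [PhiFiber, Set.mem_setOf_eq, Set.mem_singleton_iff]
  constructor
  · rintro ⟨hy, e⟩
    have : Pos n y := fun r => by rw [← e]; exact Phi_Pos r hy
    have := Pos_unique hn this hx (mem_simplex'.1 hy).2.1 tx
    ext i; exact congrFun this i
  · rintro rfl
    refine ⟨mem_simplex'.2 ⟨hx.nn, tx, (Pos_sp hn hx (by linarith)).2.2⟩, ?_⟩
    funext r; exact Pos_Phi r hn hx tx

def CD (n : ℕ → ℕ) (x : Fin 3 → ℝ) : Prop := nn x ∧ ∀ r, 0 ≤ dot (gfun n r) x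

lemma CD_g0 {n : ℕ → ℕ} {x : Fin 3 → ℝ} (h : CD n x) : 0 ≤ x 0 - n 0 * x 2 := by
  have := h.2 0
  simp [gfun, dot] at this
  linarith

lemma CD_next {n : ℕ → ℕ} {x : Fin 3 → ℝ} (h : CD n x) (hT : x 0 ≤ (n 0 + 1) * x 2) :
    CD (shift n) (Nv (n 0) x) := by
  refine ⟨⟨h.1.2.1, CD_g0 h, ?_⟩, fun r => ?_⟩
  · simp; linarith
  · rw [dot_Nv]; exact h.2 (r + 1)

lemma CD_prev {n : ℕ → ℕ} {y : Fin 3 → ℝ} (h : CD (shift n) y) : CD n (Mv (n 0) y) := by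
  refine ⟨nn_Mv h.1, fun r => ?_⟩
  cases r with
  | zero =>
    have := h.1.2.1
    simp [gfun, dot]; linarith
  | succ r =>
    have := h.2 r
    rwa [← Nv_Mv (n 0) y, dot_Nv] at this

lemma CD_smul {n : ℕ → ℕ} {x : Fin 3 → ℝ} {c : ℝ} (hc : 0 ≤ c) (h : CD n x) : CD n (c • x) :=
  ⟨nn_smul hc h.1, fun r => by rw [dot_smul]; exact mul_nonneg hc (h.2 r)⟩

lemma Pos_CD_aux (r : ℕ) : ∀ {n : ℕ → ℕ} {x : Fin 3 → ℝ}, Pos n x → 0 ≤ dot (gfun n r) x := by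
  induction r with
  | zero =>
    intro n x h
    have := h.next.nn.2.1
    simp at this
    simp [gfun, dot]; linarith
  | succ r ih =>
    intro n x h
    have := ih h.next
    rwa [dot_Nv] at this

lemma Pos_CD {n : ℕ → ℕ} {x : Fin 3 → ℝ} (h : Pos n x) : CD n x :=
  ⟨h.nn, fun r => Pos_CD_aux r h⟩

lemma Fr_ex {x : Fin 3 → ℝ} (h : nn x) (t : 0 < tot x) : ∃ u, InSigma 3 u ∧ Fr u x ∧
    (x 2 = 0 → ∀ i, u i < 2) := by
  obtain ⟨a, b, c⟩ := nn_smul (c := (tot x)⁻¹) (by positivity) h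
  obtain ⟨u, h1, h2, h3⟩ := exists_freq (x := (tot x)⁻¹ • x)
    (by intro i; fin_cases i <;> assumption)
    (by have := tot_smul (tot x)⁻¹ x
        rw [inv_mul_cancel₀ t.ne'] at this; exact this)
  refine ⟨u, h1, ?_, fun h0 => h3 (by simp [h0])⟩
  have := Fr_smul t h2
  rwa [smul_smul, mul_inv_cancel₀ t.ne', one_smul] at this

lemma exists_word (r : ℕ) : ∀ {n : ℕ → ℕ} {x : Fin 3 → ℝ}, H n → CD n x → 0 < tot x →
    ¬ nn (orb n r x) → ∃ v ∈ Xset 3 (Sseq 3 n), Fr v x := by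
  induction r with
  | zero => intro n x _ h _ h'; exact absurd h.1 h'
  | succ r ih =>
    intro n x hn hx tx hr
    by_cases hT : x 0 < (n 0 + 1) * x 2
    · have h1 := CD_next hx hT.le
      obtain ⟨v, hv, hf⟩ := ih (H_shift hn) h1 (tot_Nv_pos hx.1 h1.1 tx) hr
      refine ⟨lamSub 3 (n 0) v, ?_, ?_⟩
      · rw [S_rec hn]
        exact lam_mem_X _ (S_sigma (H_shift hn)) (S_zero (H_shift hn)) hv
      · have := Fr_lam (n := n 0) hv.1 hf
        rwa [Mv_Nv] at this
    · push Not at hT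
      obtain ⟨a, b, c⟩ := hx.1
      rcases c.eq_or_lt with c0 | c0
      · obtain ⟨u, h1, h2, h3⟩ := Fr_ex hx.1 tx
        refine ⟨u, ⟨h1, fun r => Or.inl (seqLt_of_head ?_)⟩, h2⟩
        rw [S_zero hn, shift_iter_apply]
        exact h3 c0.symm _
      · have j1 := Nat.floor_le (div_nonneg a c)
        have j2 := Nat.lt_floor_add_one (x 0 / x 2)
        have hj : n 0 < ⌊x 0 / x 2⌋₊ := by
          rw [← Nat.succ_le_iff, Nat.le_floor_iff (by positivity), le_div_iff₀ c0]
          push_cast; linarith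
        set j := ⌊x 0 / x 2⌋₊
        rw [le_div_iff₀ c0] at j1
        rw [div_lt_iff₀ c0] at j2
        have hN : nn (Nv j x) := ⟨b, by simp; linarith, by simp; linarith⟩
        obtain ⟨u, h1, h2, h3⟩ := Fr_ex hN (tot_Nv_pos hx.1 hN tx)
        refine ⟨lamSub 3 j u, ?_, ?_⟩
        · rw [S_rec hn]
          exact lam_mem_X_lt _ _ hj (S_sigma (H_shift hn)) (S_zero (H_shift hn)) h1
        · have := Fr_lam (n := j) h1 h2
          rwa [Mv_Nv] at this

lemma DFn_eq {n : ℕ → ℕ} (hn : H n) : DFn 3 n = {x : E 3 | CD n x ∧ tot x = 1} := by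
  ext x
  constructor
  · intro hx
    obtain ⟨a, b⟩ := mem_simplex.1 hx.1
    exact ⟨⟨a, fun r => dot_gfun_nonneg hn hx r⟩, b⟩
  · rintro ⟨hx, tx⟩
    have hs := mem_simplex.2 ⟨hx.1, tx⟩
    refine ⟨hs, ?_⟩
    by_cases hP : Pos n x
    · exact ⟨_, S_mem_X hn, freq_of_Fr (S_sigma hn) hs (Fr_S hn tx (mtc_eventually hn hP tx))⟩
    · unfold Pos at hP
      push Not at hP
      obtain ⟨r, hr⟩ := hP
      obtain ⟨v, hv, hf⟩ := exists_word r hn hx (by linarith) hr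
      exact ⟨v, hv, freq_of_Fr hv.1 hs hf⟩



lemma Ex1 {r : ℕ} : ∀ {n : ℕ → ℕ} {z y : Fin 3 → ℝ}, H n → nn z → (n 0 + 1) * z 2 ≤ z 0 → CD n y →
    Pos n (z + y) → 0 < tot (z + y) → nn (orb n r y) := by
  induction r with
  | zero => intro n z y _ _ _ h _ _; exact h.1
  | succ r ih =>
    intro n z y hn hz hzT hy hP ht
    have hp := Pos_sp (H_shift hn) hP.next (tot_Nv_pos hP.nn hP.next.nn ht)
    have hp2 := hp.2.2
    rw [Nv_add] at hp2
    simp only [Pi.add_apply] at hp2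
    set a := Nv (n 0) z with ha
    set b := Nv (n 0) y with hb
    have a2 : a 2 ≤ 0 := by rw [ha]; simp; linarith
    have b2 : 0 < b 2 := by linarith
    have hyT : y 0 ≤ (n 0 + 1) * y 2 := by
      have : b 2 = (n 0 + 1) * y 2 - y 0 := rfl
      linarith
    have hby := CD_next hy hyT
    rw [← hb] at hby
    set s := - a 2 / b 2 with hs
    have s0 : 0 ≤ s := by rw [hs]; apply div_nonneg <;> linarith
    have s1 : s < 1 := by rw [hs, div_lt_one b2]; linarith
    have hsb : s * b 2 = - a 2 := by rw [hs]; field_simp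
    have ea1 : 0 ≤ a 1 := by
      have : a 1 = z 0 - n 0 * z 2 := rfl
      rw [this]; linarith [hz.2.2]
    have e : (a + s • b) + (1 - s) • b = a + b := by
      funext i; simp; ring
    have := ih (n := shift n) (z := a + s • b) (y := (1 - s) • b) (H_shift hn) ⟨?_, ?_, ?_⟩ ?_
      (CD_smul (by linarith) hby) ?_ ?_
    · rw [orb_smul] at this
      have := nn_smul (c := (1 - s)⁻¹) (by rw [inv_nonneg]; linarith) this
      rwa [smul_smul, inv_mul_cancel₀ (by linarith), one_smul] at this
    · have : 0 ≤ a 0 := hz.2.1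
      have := hby.1.1
      simp; positivity
    · have := hby.1.2.1
      simp; positivity
    · simp; linarith
    · have e2 : (a + s • b) 2 = 0 := by simp; linarith
      rw [e2, mul_zero]
      have : 0 ≤ a 0 := hz.2.1
      have := hby.1.1
      simp; positivity
    · rw [e, ← Nv_add]; exact hP.next
    · rw [e, ← Nv_add]; exact tot_Nv_pos hP.nn hP.next.nn ht

lemma Ex2 {r : ℕ} : ∀ {n : ℕ → ℕ} {x y : Fin 3 → ℝ}, H n → CD n x → CD n y →
    Pos n (x + y) → 0 < tot (x + y) → Pos n x ∨ Pos n y ∨ (nn (orb n r x) ∧ nn (orb n r y)) := by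
  induction r with
  | zero => intro n x y _ hx hy _ _; exact Or.inr (Or.inr ⟨hx.1, hy.1⟩)
  | succ r ih =>
    intro n x y hn hx hy hP ht
    by_cases h1 : x 0 < (n 0 + 1) * x 2
    · by_cases h2 : y 0 < (n 0 + 1) * y 2
      · rcases ih (H_shift hn) (CD_next hx h1.le) (CD_next hy h2.le) (by rw [← Nv_add]; exact hP.next)
          (by rw [← Nv_add]; exact tot_Nv_pos hP.nn hP.next.nn ht) with h | h | h
        · exact Or.inl (Pos.mk hx.1 h)
        · exact Or.inr (Or.inl (Pos.mk hy.1 h))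
        · exact Or.inr (Or.inr h)
      · push Not at h2
        left
        rw [add_comm] at hP ht
        exact fun s => Ex1 hn hy.1 h2 hx hP ht
    · push Not at h1
      right; left
      exact fun s => Ex1 hn hx.1 h1 hy hP ht

lemma Ex3 {n : ℕ → ℕ} {x y : Fin 3 → ℝ} (hn : H n) (hx : CD n x) (hy : CD n y)
    (hP : Pos n (x + y)) (ht : 0 < tot (x + y)) : Pos n x ∨ Pos n y := by
  by_contra hc
  push Not at hc
  refine hc.1 fun r => ?_
  rcases Ex2 (r := r) hn hx hy hP ht with h | h | h
  · exact absurd h hc.1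
  · exact absurd h hc.2
  · exact h.1

lemma alpha_extreme {n : ℕ → ℕ} (hn : H n) {α : E 3} (hα : Pos n α) (tα : tot α = 1) :
    α ∈ Set.extremePoints ℝ (DFn 3 n) := by
  rw [DFn_eq hn]
  refine ⟨⟨Pos_CD hα, tα⟩, ?_⟩
  rintro x ⟨hx, tx⟩ y ⟨hy, ty⟩ ⟨a, b, ha, hb, hab, e⟩
  have e' : (a • (x : Fin 3 → ℝ)) + b • (y : Fin 3 → ℝ) = (α : Fin 3 → ℝ) := by
    rw [← e]; rfl
  have ht : 0 < tot (a • (x : Fin 3 → ℝ) + b • (y : Fin 3 → ℝ)) := by rw [e', tα]; norm_num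
  have key : ∀ (z : E 3) (c : ℝ), 0 < c → tot z = 1 → Pos n (c • (z : Fin 3 → ℝ)) → z = α := by
    intro z c hc tz hz
    have := hz.smul (c := c⁻¹) (by positivity)
    rw [smul_smul, inv_mul_cancel₀ hc.ne', one_smul] at this
    have := Pos_unique hn this hα tz tα
    ext i; exact congrFun this i
  rcases Ex3 hn (CD_smul ha.le hx) (CD_smul hb.le hy) (by rw [e']; exact hα) ht with h | h
  · exact key x a ha tx h
  · have hy' := key y b hb ty h
    rw [hy'] at e'
    ext i
    have := congrFun e' i
    simp at this
    have h1 : a * (x i - α i) = 0 := by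
      have : b = 1 - a := by linarith
      subst this; linarith
    rcases mul_eq_zero.1 h1 with h | h <;> linarith

@[simp] lemma Mt_0 (m : ℕ) (x : Fin 3 → ℝ) : Mt m x 0 = x 1 := rfl
@[simp] lemma Mt_1 (m : ℕ) (x : Fin 3 → ℝ) : Mt m x 1 = (m + 1) * x 0 + x 2 := rfl
@[simp] lemma Mt_2 (m : ℕ) (x : Fin 3 → ℝ) : Mt m x 2 = m * x 0 + x 2 := rfl
@[simp] lemma Nt_0 (m : ℕ) (x : Fin 3 → ℝ) : Nt m x 0 = x 1 - x 2 := rfl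
@[simp] lemma Nt_1 (m : ℕ) (x : Fin 3 → ℝ) : Nt m x 1 = x 0 := rfl

/-- Functionals supporting the cone along the ray of `α`. -/
def Nm (n : ℕ → ℕ) (α f : Fin 3 → ℝ) : Prop :=
  (∀ r, 0 ≤ mtc n r f 0 ∧ 0 ≤ mtc n r f 1) ∧ dot f α = 0

lemma Nm.next {n : ℕ → ℕ} {α f : Fin 3 → ℝ} (h : Nm n α f) :
    Nm (shift n) (Nv (n 0) α) (Mt (n 0) f) :=
  ⟨fun r => h.1 (r + 1), by rw [← dot_Mv, Mv_Nv]; exact h.2⟩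

lemma CD_e0 (n : ℕ → ℕ) : CD n ![1, 0, 0] := by
  refine ⟨by simp [nn], fun r => ?_⟩
  have := (gfun_sign n r).1
  simpa [dot] using this
lemma CD_e1 (n : ℕ → ℕ) : CD n ![0, 1, 0] := by
  refine ⟨by simp [nn], fun r => ?_⟩
  have := (gfun_sign n r).2.1
  simpa [dot] using this

lemma Nm_aux (r : ℕ) : ∀ {n : ℕ → ℕ} {f : Fin 3 → ℝ}, (∀ x, CD n x → 0 ≤ dot f x) →
    0 ≤ mtc n r f 0 ∧ 0 ≤ mtc n r f 1 := by
  induction r with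
  | zero =>
    intro n f h
    have h0 := h _ (CD_e0 n)
    have h1 := h _ (CD_e1 n)
    simp [dot] at h0 h1
    exact ⟨h0, h1⟩
  | succ r ih =>
    intro n f h
    exact ih (n := shift n) (f := Mt (n 0) f) fun x hx => by
      rw [← dot_Mv]; exact h _ (CD_prev hx)

lemma Nm_nonneg_aux (r : ℕ) : ∀ {n : ℕ → ℕ} {α f x : Fin 3 → ℝ}, Nm n α f → CD n x →
    ¬ nn (orb n r x) → 0 ≤ dot f x := by
  induction r with
  | zero => intro n α f x _ hx h; exact absurd hx.1 h
  | succ r ih =>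
    intro n α f x hf hx h
    by_cases hT : x 0 < (n 0 + 1) * x 2
    · have := ih hf.next (CD_next hx hT.le) h
      rwa [← dot_Mv, Mv_Nv] at this
    · push Not at hT
      have h1 := (hf.1 0)
      have h2 := (hf.1 1).2
      simp only [mtc, Mt_1] at h1 h2
      obtain ⟨a, b, c⟩ := hx.1
      have e : dot f x = (x 0 - (n 0 + 1) * x 2) * f 0 + x 1 * f 1 +
        x 2 * ((n 0 + 1) * f 0 + f 2) := by unfold dot; ring
      rw [e]
      have := mul_nonneg (sub_nonneg.2 hT) h1.1
      have := mul_nonneg b h1.2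
      have := mul_nonneg c h2
      linarith

lemma Nm_nonneg {n : ℕ → ℕ} {α f x : Fin 3 → ℝ} (hn : H n) (hα : Pos n α) (tα : tot α = 1)
    (hf : Nm n α f) (hx : CD n x) (tx : tot x = 1) : 0 ≤ dot f x := by
  by_cases hP : Pos n x
  · rw [Pos_unique hn hP hα tx tα, hf.2]
  · unfold Pos at hP
    push Not at hP
    obtain ⟨r, hr⟩ := hP
    exact Nm_nonneg_aux r hf hx hr



lemma step_eq {m : ℕ} {α f : Fin 3 → ℝ} (h : dot f α = 0) :
    Nv m α 2 * f 0 = α 2 * Mt m f 1 + α 1 * Mt m f 0 := by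
  unfold dot at h
  simp only [Nv_2, Mt_1, Mt_0]; linarith

lemma Nm_zero {n : ℕ → ℕ} {α f : Fin 3 → ℝ} (hα : sp α) (hf : Nm n α f) (h0 : f 0 = 0) :
    f 1 = 0 ∧ f 2 = 0 := by
  have h := step_eq (m := n 0) hf.2
  have h1 := hf.1 1
  simp only [mtc] at h1
  rw [h0, mul_zero] at h
  obtain ⟨a, b, c⟩ := hα
  have e1 : f 1 = 0 := by
    have p1 := mul_nonneg c.le h1.2
    have p2 := mul_nonneg b.le h1.1
    have : α 1 * Mt (n 0) f 0 = 0 := by linarith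
    rcases mul_eq_zero.1 this with h | h
    · linarith
    · exact h
  refine ⟨e1, ?_⟩
  have := hf.2
  simp only [dot, h0, e1, zero_mul, zero_add] at this
  rcases mul_eq_zero.1 this with h | h
  · exact h
  · linarith

lemma Nm_pos {n : ℕ → ℕ} {α f : Fin 3 → ℝ} (hn : H n) (hα : Pos n α) (tα : 0 < tot α)
    (hf : Nm n α f) (h0 : 0 < f 0) : 0 < f 1 := by
  refine lt_of_le_of_ne (hf.1 0).2 fun h => ?_
  have := Nm_zero (Pos_sp (H_shift hn) hα.next (tot_Nv_pos hα.nn hα.next.nn tα)) hf.next h.symm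
  simp at this
  linarith

def Rel (ρ : ℝ) (f g : Fin 3 → ℝ) : Prop := f 0 * g 1 ≤ ρ * (g 0 * f 1) ∧ g 0 * f 1 ≤ ρ * (f 0 * g 1)

lemma Rel_step1 {ρ a D c f0 g0 f0' f1' g0' g1' : ℝ} (hρ : 1 ≤ ρ) (hD : 0 < D) (ha : 0 ≤ a)
    (hc : 0 ≤ c)
    (hf : D * f0 = c * f1' + a * f0') (hg : D * g0 = c * g1' + a * g0')
    (p : 0 ≤ f0' * g0') (h : f1' * g0' ≤ ρ * (g1' * f0')) :
    f0 * g0' ≤ ρ * (g0 * f0') := by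
  have e1 : D * (f0 * g0') = c * (f1' * g0') + a * (f0' * g0') := by
    rw [← mul_assoc, hf]; ring
  have e2 : D * (ρ * (g0 * f0')) = ρ * (c * (g1' * f0') + a * (f0' * g0')) := by
    have : D * (ρ * (g0 * f0')) = ρ * ((D * g0) * f0') := by ring
    rw [this, hg]; ring
  have k1 := mul_le_mul_of_nonneg_left h hc
  have k2 := mul_le_mul_of_nonneg_right hρ (mul_nonneg ha p)
  refine le_of_mul_le_mul_left ?_ hD
  rw [e1, e2]; linarith

lemma Rel_step2 {ρ a D c f0 g0 f0' f1' g0' g1' : ℝ} (hρ : 1 ≤ ρ) (hD : 0 < D)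
    (hc : 0 ≤ c) (hac : c ≤ 3 * a)
    (hf : D * f0 = c * f1' + a * f0') (hg : D * g0 = c * g1' + a * g0')
    (pf : 0 ≤ f0') (p : 0 ≤ f0' * g0') (h : f1' * g0' ≤ ρ * (g1' * f0'))
    (hg3 : g1' ≤ 3 * g0') :
    f0 * g0' ≤ (1 + 9 / 10 * (ρ - 1)) * (g0 * f0') := by
  have e1 : D * (f0 * g0') = c * (f1' * g0') + a * (f0' * g0') := by
    rw [← mul_assoc, hf]; ring
  have e2 : D * ((1 + 9 / 10 * (ρ - 1)) * (g0 * f0')) =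
      (1 + 9 / 10 * (ρ - 1)) * (c * (g1' * f0') + a * (f0' * g0')) := by
    have : D * ((1 + 9 / 10 * (ρ - 1)) * (g0 * f0')) =
      (1 + 9 / 10 * (ρ - 1)) * ((D * g0) * f0') := by ring
    rw [this, hg]; ring
  have k1 := mul_le_mul_of_nonneg_left h hc
  have k2 : g1' * f0' ≤ 3 * (f0' * g0') := by nlinarith
  have k3 : c * (g1' * f0') ≤ 9 * (a * (f0' * g0')) := by
    have := mul_le_mul_of_nonneg_left k2 hc
    have := mul_le_mul_of_nonneg_right hac p
    linarith
  have k4 := mul_le_mul_of_nonneg_left k3 (sub_nonneg.2 hρ)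
  refine le_of_mul_le_mul_left ?_ hD
  rw [e1, e2]; linarith

lemma Rel_base {a D c f0 g0 f0' f1' g0' g1' : ℝ} (hD : 0 < D)
    (hc : 0 ≤ c) (hac : c ≤ 3 * a)
    (hf : D * f0 = c * f1' + a * f0') (hg : D * g0 = c * g1' + a * g0')
    (pf : 0 ≤ f0') (pg : 0 ≤ g0') (pg1 : 0 ≤ g1') (p : 0 ≤ f0' * g0')
    (hf3 : f1' ≤ 3 * f0') :
    f0 * g0' ≤ 10 * (g0 * f0') := by
  have e1 : D * (f0 * g0') = c * (f1' * g0') + a * (f0' * g0') := by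
    rw [← mul_assoc, hf]; ring
  have e2 : D * (10 * (g0 * f0')) = 10 * (c * (g1' * f0') + a * (f0' * g0')) := by
    have : D * (10 * (g0 * f0')) = 10 * ((D * g0) * f0') := by ring
    rw [this, hg]; ring
  have k1 : f1' * g0' ≤ 3 * (f0' * g0') := by nlinarith
  have k2 := mul_le_mul_of_nonneg_left k1 hc
  have k3 := mul_le_mul_of_nonneg_right hac p
  have k4 := mul_nonneg hc (mul_nonneg pg1 pf)
  refine le_of_mul_le_mul_left ?_ hD
  rw [e1, e2]; linarith

structure Dat (n : ℕ → ℕ) (α f g : Fin 3 → ℝ) : Prop where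
  hn : H n
  hα : Pos n α
  tα : 0 < tot α
  hf : Nm n α f
  hg : Nm n α g
  f0 : 0 < f 0
  g0 : 0 < g 0

lemma Dat.next {n : ℕ → ℕ} {α f g : Fin 3 → ℝ} (d : Dat n α f g) :
    Dat (shift n) (Nv (n 0) α) (Mt (n 0) f) (Mt (n 0) g) :=
  ⟨H_shift d.hn, d.hα.next, tot_Nv_pos d.hα.nn d.hα.next.nn d.tα, d.hf.next, d.hg.next,
    Nm_pos d.hn d.hα d.tα d.hf d.f0, Nm_pos d.hn d.hα d.tα d.hg d.g0⟩

lemma Dat.symm {n : ℕ → ℕ} {α f g : Fin 3 → ℝ} (d : Dat n α f g) : Dat n α g f :=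
  ⟨d.hn, d.hα, d.tα, d.hg, d.hf, d.g0, d.f0⟩

lemma Dat.sp {n : ℕ → ℕ} {α f g : Fin 3 → ℝ} (d : Dat n α f g) : sp α := Pos_sp d.hn d.hα d.tα

lemma Rel_prev {n : ℕ → ℕ} {α f g : Fin 3 → ℝ} {ρ : ℝ} (hρ : 1 ≤ ρ) (d : Dat n α f g)
    (h : Rel ρ (Mt (n 0) f) (Mt (n 0) g)) : Rel ρ f g := by
  have d' := d.next
  have ef := step_eq (m := n 0) d.hf.2
  have eg := step_eq (m := n 0) d.hg.2
  have pf := d'.f0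
  have pg := d'.g0
  have hD := d'.sp.2.2
  obtain ⟨-, a1, a2⟩ := d.sp
  constructor
  · refine Rel_step1 hρ hD a1.le a2.le ef eg (by positivity) ?_
    simp only [Rel, Mt_0] at h
    linarith [h.2]
  · refine Rel_step1 hρ hD a1.le a2.le eg ef (by positivity) ?_
    simp only [Rel, Mt_0] at h
    linarith [h.1]

lemma three_ones {n : ℕ → ℕ} {α : Fin 3 → ℝ} (hα : Pos n α)
    (a : n 0 = 1) (b : n 1 = 1) (c : n 2 = 1) : α 2 ≤ 3 * α 1 := by
  have e : α = B (Nv (shift (shift n) 0) (Nv (shift n 0) (Nv (n 0) α))) := by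
    simp [shift, a, b, c, B, Mv_Nv]
  obtain ⟨p0, p1, p2⟩ := hα.next.next.next.nn
  rw [e, B_1, B_2]
  linarith

lemma three_bound {n : ℕ → ℕ} {α f g : Fin 3 → ℝ} (d : Dat n α f g)
    (a : n 0 = 1) (b : n 1 = 1) (c : n 2 = 1) : f 1 ≤ 3 * f 0 := by
  have h3 := three_ones d.hα a b c
  have ef := step_eq (m := n 0) d.hf.2
  have d1 := (d.hf.1 1).2
  simp only [mtc] at d1
  have hD := d.next.sp.2.2
  have hD1 := d.hα.next.nn.2.1
  simp only [Nv_1] at hD1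
  have hD2 : Nv (n 0) α 2 ≤ α 2 := by simp only [Nv_2]; linarith
  obtain ⟨-, a1, a2⟩ := d.sp
  have f0 := d.f0
  have f1 : 0 < f 1 := d.next.f0
  have k1 := mul_nonneg a2.le d1
  have k2 : α 1 * f 1 ≤ α 2 * f 0 := by
    have := mul_le_mul_of_nonneg_right hD2 f0.le
    simp only [Mt_0] at ef
    linarith
  have k3 := mul_le_mul_of_nonneg_right h3 f1.le
  refine le_of_mul_le_mul_left ?_ a2
  linarith

lemma Rel_good {n : ℕ → ℕ} {α f g : Fin 3 → ℝ} (d : Dat n α f g)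
    (a : n 0 = 1) (b : n 1 = 1) (c : n 2 = 1) (e : n 3 = 1) : Rel 10 f g ∧
    ∀ ρ, 1 ≤ ρ → Rel ρ (Mt (n 0) f) (Mt (n 0) g) → Rel (1 + 9 / 10 * (ρ - 1)) f g := by
  have d' := d.next
  have ef := step_eq (m := n 0) d.hf.2
  have eg := step_eq (m := n 0) d.hg.2
  have pf := d'.f0
  have pg := d'.g0
  have hD := d'.sp.2.2
  have h3 := three_ones d.hα a b c
  have bf := three_bound d' b c e
  have bg := three_bound d'.symm b c e
  have f1 := (d'.hf.1 0).2
  have g1 := (d'.hg.1 0).2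
  simp only [mtc] at f1 g1
  obtain ⟨-, a1, a2⟩ := d.sp
  refine ⟨⟨?_, ?_⟩, fun ρ hρ h => ⟨?_, ?_⟩⟩
  · exact Rel_base hD a2.le h3 ef eg pf.le pg.le g1 (by positivity) bf
  · exact Rel_base hD a2.le h3 eg ef pg.le pf.le f1 (by positivity) bg
  · refine Rel_step2 hρ hD a2.le h3 ef eg pf.le (by positivity) ?_ bg
    simp only [Rel, Mt_0] at h
    linarith [h.2]
  · refine Rel_step2 hρ hD a2.le h3 eg ef pg.le (by positivity) ?_ bf
    simp only [Rel, Mt_0] at h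
    linarith [h.1]

lemma Rel_descend {ρ : ℝ} (hρ : 1 ≤ ρ)
    (h : ∀ {n : ℕ → ℕ} {α f g : Fin 3 → ℝ}, Dat n α f g → n 0 = 1 → n 1 = 1 → n 2 = 1 →
      n 3 = 1 → Rel ρ f g) (r : ℕ) : ∀ {n : ℕ → ℕ} {α f g : Fin 3 → ℝ}, Dat n α f g →
      n r = 1 → n (r + 1) = 1 → n (r + 2) = 1 → n (r + 3) = 1 → Rel ρ f g := by
  induction r with
  | zero => exact h
  | succ r ih =>
    intro n α f g d a b c e
    exact Rel_prev hρ d (ih d.next a b c e)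

lemma Rel_all (k : ℕ) : ∀ {n : ℕ → ℕ} {α f g : Fin 3 → ℝ}, Dat n α f g →
    Rel (1 + (9 / 10) ^ k * 9) f g := by
  induction k with
  | zero =>
    intro n α f g d
    obtain ⟨r, -, a, b, c, e, -⟩ := d.hn 0
    refine Rel_descend (by norm_num) ?_ r d a b c e
    intro n α f g d a b c e
    have := (Rel_good d a b c e).1
    norm_num; exact this
  | succ k ih =>
    intro n α f g d
    obtain ⟨r, -, a, b, c, e, -⟩ := d.hn 0
    have hp : (0:ℝ) < (9 / 10) ^ k := by positivity
    have hp' : (0:ℝ) < (9 / 10) ^ (k + 1) := by positivity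
    refine Rel_descend (by linarith) ?_ r d a b c e
    intro n α f g d a b c e
    have := (Rel_good d a b c e).2 _ (by linarith) (ih d.next)
    convert this using 1
    ring

lemma Rel_le {n : ℕ → ℕ} {α f g : Fin 3 → ℝ} (d : Dat n α f g) : f 0 * g 1 ≤ g 0 * f 1 := by
  have h2 : Tendsto (fun k : ℕ => (1 + (9 / 10 : ℝ) ^ k * 9) * (g 0 * f 1)) atTop
      (𝓝 ((1 + 0 * 9) * (g 0 * f 1))) :=
    (((tendsto_pow_atTop_nhds_zero_of_lt_one (by norm_num) (by norm_num)).mul_const _).const_add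
      _).mul_const _
  have := ge_of_tendsto' h2 fun k => (Rel_all k d).1
  linarith

lemma normal_unique {n : ℕ → ℕ} {α f g : Fin 3 → ℝ} (d : Dat n α f g) (i : Fin 3) :
    g 0 * f i = f 0 * g i := by
  have h1 := Rel_le d
  have h2 := Rel_le d.symm
  have e1 : g 0 * f 1 = f 0 * g 1 := le_antisymm h2 h1
  have a2 := d.sp.2.2
  have ff := d.hf.2
  have gg := d.hg.2
  unfold dot at ff gg
  fin_cases i
  · simp; ring
  · exact e1
  · simp
    refine mul_right_cancel₀ a2.ne' ?_
    linear_combination g 0 * ff - f 0 * gg - α 1 * e1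



lemma ex_finite (r : ℕ) : ∀ {n : ℕ → ℕ} {α : Fin 3 → ℝ}, H n → Pos n α → 0 < tot α →
    ∃ f : Fin 3 → ℝ, dot f α = 0 ∧ 0 < f 0 + f 1 ∧
      ∀ s ≤ r, 0 ≤ mtc n s f 0 ∧ 0 ≤ mtc n s f 1 := by
  induction r with
  | zero =>
    intro n α hn hα tα
    obtain ⟨a, b, c⟩ := Pos_sp hn hα tα
    refine ⟨![1, 0, -α 0 / α 2], ?_, ?_, ?_⟩
    · simp [dot]; field_simp; ring
    · simp
    · intro s hs
      obtain rfl : s = 0 := by omega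
      simp [mtc]
  | succ r ih =>
    intro n α hn hα tα
    have tα' := tot_Nv_pos hα.nn hα.next.nn tα
    obtain ⟨f, h1, h2, h3⟩ := ih (H_shift hn) hα.next tα'
    obtain ⟨a, b, c⟩ := Pos_sp (H_shift hn) hα.next tα'
    have h30 := h3 0 (by omega)
    simp only [mtc] at h30
    have f2 : f 2 ≤ 0 := by
      by_contra hc
      push Not at hc
      have := mul_nonneg h30.1 a.le
      have := mul_nonneg h30.2 b.le
      have := mul_pos hc c
      unfold dot at h1
      linarith
    refine ⟨Nt (n 0) f, ?_, ?_, ?_⟩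
    · rw [← dot_Nv]; exact h1
    · simp only [Nt_0, Nt_1]; linarith
    · intro s hs
      cases s with
      | zero => simp only [mtc, Nt_0, Nt_1]; exact ⟨by linarith, h30.1⟩
      | succ s => simp only [mtc, Mt_Nt]; exact h3 s (by omega)

lemma Mt_smul (m : ℕ) (c : ℝ) (x : Fin 3 → ℝ) : Mt m (c • x) = c • Mt m x := by
  funext i; fin_cases i <;> simp [Mt] <;> ring
lemma mtc_smul (r : ℕ) (c : ℝ) : ∀ (n : ℕ → ℕ) (x : Fin 3 → ℝ),
    mtc n r (c • x) = c • mtc n r x := by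
  induction r with
  | zero => intro n x; rfl
  | succ r ih => intro n x; simp only [mtc, Mt_smul, ih]
lemma Mt_cont (m : ℕ) : Continuous (Mt m) := by
  unfold Mt
  refine continuous_pi fun i => ?_
  fin_cases i <;> simp <;> fun_prop
lemma mtc_cont (r : ℕ) : ∀ n, Continuous (mtc n r) := by
  induction r with
  | zero => intro n; exact continuous_id
  | succ r ih => intro n; exact (ih (shift n)).comp (Mt_cont (n 0))

noncomputable def Fp (α : Fin 3 → ℝ) (τ : ℝ) : Fin 3 → ℝ :=
  ![τ, 1 - τ, -(α 0 * τ + α 1 * (1 - τ)) / α 2]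

lemma Fp_cont (α : Fin 3 → ℝ) : Continuous (Fp α) := by
  unfold Fp
  refine continuous_pi fun i => ?_
  fin_cases i <;> simp <;> fun_prop

lemma ex_normal {n : ℕ → ℕ} {α : Fin 3 → ℝ} (hn : H n) (hα : Pos n α) (tα : 0 < tot α) :
    ∃ f : Fin 3 → ℝ, Nm n α f ∧ 0 < f 0 := by
  obtain ⟨a, b, c⟩ := Pos_sp hn hα tα
  let C : ℕ → Set ℝ := fun r => ⋂ s ≤ r, {τ | 0 ≤ mtc n s (Fp α τ) 0} ∩ {τ | 0 ≤ mtc n s (Fp α τ) 1}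
  have hcl : ∀ r, IsClosed (C r) := by
    intro r
    have hc : ∀ (s : ℕ) (i : Fin 3), Continuous fun τ => mtc n s (Fp α τ) i := fun s i =>
      (continuous_apply i).comp ((mtc_cont s n).comp (Fp_cont α))
    exact isClosed_iInter fun s => isClosed_iInter fun _ =>
      (isClosed_le continuous_const (hc s 0)).inter (isClosed_le continuous_const (hc s 1))
  have hne : (⋂ r, C r).Nonempty := by
    refine IsCompact.nonempty_iInter_of_sequence_nonempty_isCompact_isClosed C ?_ ?_ ?_ hcl
    · intro r x hx
      simp only [C, Set.mem_iInter] at hx ⊢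
      intro s hs
      exact hx s (by omega)
    · intro r
      obtain ⟨f, h1, h2, h3⟩ := ex_finite r hn hα tα
      refine ⟨f 0 / (f 0 + f 1), ?_⟩
      have e : Fp α (f 0 / (f 0 + f 1)) = (f 0 + f 1)⁻¹ • f := by
        unfold dot at h1
        have h12 : f 2 = -(f 0 * α 0 + f 1 * α 1) / α 2 := by
          field_simp; linarith
        funext i
        fin_cases i
        · simp [Fp]; field_simp
        · simp [Fp]; field_simp; ring
        · simp [Fp, h12]; field_simp; ring
      simp only [C, Set.mem_iInter]
      intro s hs
      have := h3 s hs
      have e' : mtc n s (Fp α (f 0 / (f 0 + f 1))) = (f 0 + f 1)⁻¹ • mtc n s f := by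
        rw [e, mtc_smul]
      have hp : 0 ≤ (f 0 + f 1)⁻¹ := by positivity
      constructor
      · show 0 ≤ mtc n s (Fp α (f 0 / (f 0 + f 1))) 0
        rw [e']; exact mul_nonneg hp this.1
      · show 0 ≤ mtc n s (Fp α (f 0 / (f 0 + f 1))) 1
        rw [e']; exact mul_nonneg hp this.2
    · refine IsCompact.of_isClosed_subset (isCompact_Icc (a := (0 : ℝ)) (b := 1)) (hcl 0) ?_
      intro τ hτ
      simp [C, mtc, Fp] at hτ
      exact hτ
  obtain ⟨τ, hτ⟩ := hne
  simp only [C, Set.mem_iInter] at hτ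
  have hN : Nm n α (Fp α τ) := by
    refine ⟨fun r => hτ r r le_rfl, ?_⟩
    simp [dot, Fp]; field_simp; ring
  refine ⟨_, hN, lt_of_le_of_ne (hN.1 0).1 fun h => ?_⟩
  have := (Nm_zero ⟨a, b, c⟩ hN h.symm).1
  simp [Fp, mtc] at h this
  linarith

lemma par {y d : E 3} (ty : tot y = 0) (td : tot d = 0) (hd : d ≠ 0)
    (h : d 0 * y 1 = d 1 * y 0) : ∃ c : ℝ, c • d = y := by
  unfold tot at ty td
  by_cases h0 : d 0 = 0
  · have h1 : d 1 ≠ 0 := by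
      intro h1
      apply hd
      have h2 : d 2 = 0 := by rw [h0, h1] at td; linarith
      ext i; fin_cases i <;> simpa
    have hy0 : y 0 = 0 := by
      rw [h0, zero_mul] at h
      exact (mul_eq_zero.1 h.symm).resolve_left h1
    refine ⟨y 1 / d 1, ?_⟩
    have d2 : d 2 = - d 1 := by linarith
    have y2 : y 2 = - y 1 := by linarith
    ext i; fin_cases i
    · simp [h0, hy0]
    · simp; field_simp
    · simp [d2, y2]; field_simp
  · refine ⟨y 0 / d 0, ?_⟩
    have d2 : d 2 = - d 0 - d 1 := by linarith
    have y2 : y 2 = - y 0 - y 1 := by linarith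
    ext i; fin_cases i
    · simp; field_simp
    · simp; field_simp; linarith
    · simp [d2, y2]; field_simp; linarith

lemma tot_add (x y : Fin 3 → ℝ) : tot (x + y) = tot x + tot y := by simp [tot]; ring

lemma E_cont (f : Fin 3 → ℝ) : Continuous fun x : E 3 => dot f x := by
  unfold dot; fun_prop

lemma sum_tot (x : E 3) : ∑ i, x i = tot x := by rw [Fin.sum_univ_three]; rfl

lemma CD_of_tot {n : ℕ → ℕ} {f : Fin 3 → ℝ} (h : ∀ x : E 3, CD n x → tot x = 1 → 0 ≤ dot f x)
    (x : Fin 3 → ℝ) (hx : CD n x) : 0 ≤ dot f x := by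
  obtain ⟨a, b, c⟩ := hx.1
  have ht : 0 ≤ tot x := by unfold tot; positivity
  rcases ht.eq_or_lt with h0 | h0
  · unfold tot at h0
    have e0 : x 0 = 0 := by linarith
    have e1 : x 1 = 0 := by linarith
    have e2 : x 2 = 0 := by linarith
    simp [dot, e0, e1, e2]
  · have := h (WithLp.toLp 2 ((tot x)⁻¹ • x)) (CD_smul (by positivity) hx)
      (by show tot ((tot x)⁻¹ • x) = 1
          rw [tot_smul, inv_mul_cancel₀ h0.ne'])
    have : 0 ≤ dot f ((tot x)⁻¹ • x) := this
    rw [dot_smul] at this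
    exact (mul_nonneg_iff_of_pos_left (by positivity)).1 this

lemma normal_of_nonneg {n : ℕ → ℕ} {α f : Fin 3 → ℝ}
    (h : ∀ x : E 3, CD n x → tot x = 1 → 0 ≤ dot f x) (h0 : dot f α = 0) : Nm n α f :=
  ⟨fun r => Nm_aux r (CD_of_tot h), h0⟩

lemma line_carrier {n : ℕ → ℕ} (hn : H n) {α : E 3} (hα : Pos n α) (tα : tot α = 1)
    {g : Fin 3 → ℝ} (hg : Nm n α g) (g0 : 0 < g 0) (L : AffineSubspace ℝ (E 3))
    (hL : α ∈ L) (h1 : Module.finrank ℝ L.direction = 1)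
    (hS : (L : Set (E 3)) ⊆ {x : E 3 | ∑ i, x i = 1})
    (hC : IsConnected (DFn 3 n \ (L : Set (E 3)))) :
    (L : Set (E 3)) = {x : E 3 | tot x = 1 ∧ dot g x = 0} := by
  obtain ⟨⟨d, hdL⟩, hd0, hspan⟩ := finrank_eq_one_iff'.1 h1
  have hd : d ≠ 0 := fun h => hd0 (by simp [h])
  have td : tot d = 0 := by
    have := hS (AffineSubspace.vadd_mem_of_mem_direction hdL hL)
    have : ∑ i, (d +ᵥ α) i = 1 := this
    rw [sum_tot] at this
    have e : tot (d +ᵥ α : E 3) = tot d + tot α := tot_add d α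
    rw [e] at this; linarith
  -- a functional cutting out `L`
  obtain ⟨f, hf⟩ : ∃ f : Fin 3 → ℝ, ∀ x : Fin 3 → ℝ, dot f x = d 0 * (x 1 - α 1 * tot x) -
      d 1 * (x 0 - α 0 * tot x) := by
    refine ⟨![- d 1 - (d 0 * α 1 - d 1 * α 0), d 0 - (d 0 * α 1 - d 1 * α 0),
      - (d 0 * α 1 - d 1 * α 0)], fun x => ?_⟩
    simp [dot, tot]; ring
  have hLf : (L : Set (E 3)) = {x : E 3 | tot x = 1 ∧ dot f x = 0} := by
    ext x
    constructor
    · intro hx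
      have tx : tot x = 1 := by rw [← sum_tot]; exact hS hx
      refine ⟨tx, ?_⟩
      have := AffineSubspace.vsub_mem_direction hx hL
      obtain ⟨c, hc⟩ := hspan ⟨_, this⟩
      have hc : c • d = x - α := congrArg Subtype.val hc
      have c0 : c * d 0 = x 0 - α 0 := by
        have := congrArg (fun z : E 3 => z 0) hc; simpa using this
      have c1 : c * d 1 = x 1 - α 1 := by
        have := congrArg (fun z : E 3 => z 1) hc; simpa using this
      rw [hf, tx, mul_one, mul_one, ← c0, ← c1]; ring
    · rintro ⟨tx, hx⟩
      rw [hf, tx] at hx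
      have ty : tot (x - α : E 3) = 0 := by
        have : tot (x - α : E 3) = tot x - tot α := by simp [tot]; ring
        rw [this, tx, tα, sub_self]
      obtain ⟨c, hc⟩ := par ty td hd (by simp; linarith)
      have := AffineSubspace.vadd_mem_of_mem_direction (L.direction.smul_mem c hdL) hL
      rw [hc] at this
      simpa using this
  have hfα : dot f α = 0 := by rw [hf, tα]; ring
  -- constant sign
  have hsign : (∀ x : E 3, CD n x → tot x = 1 → 0 ≤ dot f x) ∨
      (∀ x : E 3, CD n x → tot x = 1 → dot f x ≤ 0) := by
    by_contra hcon
    push Not at hcon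
    obtain ⟨⟨x, hx, tx, fx⟩, y, hy, ty, fy⟩ := hcon
    have mx : x ∈ DFn 3 n \ (L : Set (E 3)) := by
      rw [DFn_eq hn, hLf]; exact ⟨⟨hx, tx⟩, fun h => fx.ne h.2⟩
    have my : y ∈ DFn 3 n \ (L : Set (E 3)) := by
      rw [DFn_eq hn, hLf]; exact ⟨⟨hy, ty⟩, fun h => fy.ne' h.2⟩
    obtain ⟨z, hz, ez⟩ := hC.isPreconnected.intermediate_value mx my (E_cont f).continuousOn
      (⟨fx.le, fy.le⟩ : (0 : ℝ) ∈ Set.Icc (dot f x) (dot f y))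
    rw [DFn_eq hn, hLf] at hz
    exact hz.2 ⟨hz.1.2, ez⟩
  have hspα : sp α := Pos_sp hn hα (by linarith)
  -- a nonzero multiple of `f` is normal
  have main : ∀ f' : Fin 3 → ℝ, (∃ ε : ℝ, ε ≠ 0 ∧ ∀ x, dot f' x = ε * dot f x) →
      Nm n α f' → (L : Set (E 3)) = {x : E 3 | tot x = 1 ∧ dot g x = 0} := by
    rintro f' ⟨ε, hε, he⟩ hN
    have f0 : 0 < f' 0 := by
      refine lt_of_le_of_ne (hN.1 0).1 fun h => hd ?_
      have h0 : f' 0 = 0 := h.symm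
      obtain ⟨h1, h2⟩ := Nm_zero hspα hN h0
      have hz : ∀ x, dot f x = 0 := by
        intro x
        have := he x
        have e : dot f' x = 0 := by simp [dot, h0, h1, h2]
        rw [e] at this
        exact (mul_eq_zero.1 this.symm).resolve_left hε
      have z1 := hz ![-1, 0, 1]
      have z2 := hz ![0, -1, 1]
      rw [hf] at z1 z2
      simp [tot] at z1 z2
      unfold tot at td
      rw [z1, z2] at td
      ext i; fin_cases i
      · simpa using z2
      · simpa using z1
      · simpa using td
    have hu := normal_unique ⟨hn, hα, by linarith, hN, hg, f0, g0⟩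
    rw [hLf]
    ext x
    have e : g 0 * (ε * dot f x) = f' 0 * dot g x := by
      rw [← he]; unfold dot
      linear_combination x 0 * hu 0 + x 1 * hu 1 + x 2 * hu 2
    constructor
    · rintro ⟨a, b⟩
      refine ⟨a, ?_⟩
      rw [b, mul_zero, mul_zero] at e
      exact (mul_eq_zero.1 e.symm).resolve_left f0.ne'
    · rintro ⟨a, b⟩
      refine ⟨a, ?_⟩
      rw [b, mul_zero] at e
      exact (mul_eq_zero.1 ((mul_eq_zero.1 e).resolve_left g0.ne')).resolve_left hε
  rcases hsign with h | h
  · exact main f ⟨1, one_ne_zero, fun x => by rw [one_mul]⟩ (normal_of_nonneg h hfα)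
  · have e : ∀ x, dot (-f) x = -1 * dot f x := fun x => by simp [dot]; ring
    refine main (-f) ⟨-1, by norm_num, e⟩ (normal_of_nonneg (fun x hx tx => ?_) ?_)
    · rw [e]; linarith [h x hx tx]
    · rw [e, hfα]; ring

lemma line_exists {n : ℕ → ℕ} (hn : H n) {α : E 3} (hα : Pos n α) (tα : tot α = 1)
    {g : Fin 3 → ℝ} (hg : Nm n α g) (g0 : 0 < g 0) : ∃ L : AffineSubspace ℝ (E 3),
      (L : Set (E 3)) = {x : E 3 | tot x = 1 ∧ dot g x = 0} ∧
      Module.finrank ℝ L.direction = 1 := by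
  let d : E 3 := !₂[g 1 - g 2, g 2 - g 0, g 0 - g 1]
  have d0 : d 0 = g 1 - g 2 := rfl
  have d1 : d 1 = g 2 - g 0 := rfl
  have d2 : d 2 = g 0 - g 1 := rfl
  have td : tot d = 0 := by unfold tot; rw [d0, d1, d2]; ring
  have hgα := hg.2
  have hd : d ≠ 0 := by
    intro h
    have e0 : d 0 = 0 := by rw [h]; rfl
    have e1 : d 1 = 0 := by rw [h]; rfl
    have e2 : g 2 = g 0 := by linarith
    have e3 : g 1 = g 0 := by linarith
    unfold dot at hgα
    rw [e2, e3, ← mul_add, ← mul_add] at hgα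
    unfold tot at tα
    rw [tα] at hgα
    linarith
  refine ⟨AffineSubspace.mk' α (Submodule.span ℝ {d}), ?_, ?_⟩
  · ext x
    rw [SetLike.mem_coe, AffineSubspace.mem_mk', Submodule.mem_span_singleton]
    constructor
    · rintro ⟨c, hc⟩
      have hc : c • d = x - α := hc
      have hx : (x : Fin 3 → ℝ) = c • (d : Fin 3 → ℝ) + α := by
        have : x = c • d + α := by rw [hc]; simp
        rw [this]; rfl
      refine ⟨?_, ?_⟩
      · rw [hx, tot_add, tot_smul, td, tα]; ring
      · rw [hx, dot_add, dot_smul, hgα]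
        have : dot g d = 0 := by unfold dot; rw [d0, d1, d2]; ring
        rw [this]; ring
    · rintro ⟨tx, hx⟩
      have ty : tot (x - α : E 3) = 0 := by
        have : tot (x - α : E 3) = tot x - tot α := by simp [tot]; ring
        rw [this, tx, tα, sub_self]
      refine par ty td hd ?_
      rw [d0, d1]
      unfold tot at ty
      have hy : dot g (x - α : E 3) = 0 := by
        have : dot g (x - α : E 3) = dot g x - dot g α := by simp [dot]; ring
        rw [this, hx, hgα, sub_self]
      unfold dot at hy
      linear_combination hy - g 2 * ty
  · rw [AffineSubspace.direction_mk', finrank_span_singleton hd]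

lemma CD_add {n : ℕ → ℕ} {x y : Fin 3 → ℝ} (hx : CD n x) (hy : CD n y) : CD n (x + y) := by
  refine ⟨⟨?_, ?_, ?_⟩, fun r => ?_⟩
  · exact add_nonneg hx.1.1 hy.1.1
  · exact add_nonneg hx.1.2.1 hy.1.2.1
  · exact add_nonneg hx.1.2.2 hy.1.2.2
  · rw [dot_add]; exact add_nonneg (hx.2 r) (hy.2 r)

lemma connected_compl {n : ℕ → ℕ} (hn : H n) {α : E 3} (hα : Pos n α) (tα : tot α = 1)
    {g : Fin 3 → ℝ} (hg : Nm n α g) (g0 : 0 < g 0) :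
    IsConnected (DFn 3 n \ {x : E 3 | tot x = 1 ∧ dot g x = 0}) := by
  have e : DFn 3 n \ {x : E 3 | tot x = 1 ∧ dot g x = 0} =
      {x : E 3 | (CD n x ∧ tot x = 1) ∧ 0 < dot g x} := by
    rw [DFn_eq hn]
    ext x
    constructor
    · rintro ⟨⟨a, b⟩, c⟩
      exact ⟨⟨a, b⟩, lt_of_le_of_ne (Nm_nonneg hn hα tα hg a b) fun h => c ⟨b, h.symm⟩⟩
    · rintro ⟨⟨a, b⟩, c⟩
      exact ⟨⟨a, b⟩, fun h => c.ne' h.2⟩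
  rw [e]
  refine ⟨⟨!₂[1, 0, 0], ?_⟩, Convex.isPreconnected ?_⟩
  · refine ⟨⟨CD_e0 n, ?_⟩, ?_⟩
    · simp [tot]
    · simpa [dot] using g0
  · rintro x ⟨⟨hx, tx⟩, gx⟩ y ⟨⟨hy, ty⟩, gy⟩ a b ha hb hab
    have ee : ((a • x + b • y : E 3) : Fin 3 → ℝ) = a • (x : Fin 3 → ℝ) + b • (y : Fin 3 → ℝ) := rfl
    refine ⟨⟨?_, ?_⟩, ?_⟩
    · rw [ee]; exact CD_add (CD_smul ha hx) (CD_smul hb hy)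
    · rw [ee, tot_add, tot_smul, tot_smul, tx, ty]; linarith
    · rw [ee, dot_add, dot_smul, dot_smul]
      rcases ha.eq_or_lt with h | h
      · have : b = 1 := by linarith
        rw [← h, this]; linarith
      · have := mul_pos h gx
        have := mul_nonneg hb gy.le
        linarith

/-- `k = 3`: if `n` contains infinitely many blocks `1 1 1 1 1`, then
`Φ^{-1}(n)` is a singleton `{α}`, `α` is an extreme point of `DF(n)`, and `α` is a smooth
extreme point: there is exactly one line `L` through `α` in the plane `{∑ xᵢ = 1}` such
that `DF(n) ∖ L` is connected. -/
theorem stmt18 (n : ℕ → ℕ)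
    (h : ∀ R, ∃ r, R ≤ r ∧ n r = 1 ∧ n (r + 1) = 1 ∧ n (r + 2) = 1 ∧
      n (r + 3) = 1 ∧ n (r + 4) = 1) :
    ∃ α : E 3, PhiFiber 3 n = {α} ∧ α ∈ Set.extremePoints ℝ (DFn 3 n) ∧
      ∃! L : AffineSubspace ℝ (E 3),
        α ∈ L ∧ Module.finrank ℝ L.direction = 1 ∧
        (L : Set (E 3)) ⊆ {x : E 3 | ∑ i, x i = 1} ∧
        IsConnected (DFn 3 n \ (L : Set (E 3))) := by
  have hn : H n := h
  obtain ⟨a, ta, ha⟩ := ex_alpha n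
  obtain ⟨α, rfl⟩ : ∃ α : E 3, (α : Fin 3 → ℝ) = a := ⟨WithLp.toLp 2 a, rfl⟩
  obtain ⟨g, hg, g0⟩ := ex_normal hn ha (by linarith)
  refine ⟨α, PhiFiber_eq hn ha ta, alpha_extreme hn ha ta, ?_⟩
  obtain ⟨L, hL, hL1⟩ := line_exists hn ha ta hg g0
  refine ⟨L, ⟨?_, hL1, ?_, ?_⟩, ?_⟩
  · rw [← SetLike.mem_coe, hL]; exact ⟨ta, hg.2⟩
  · rw [hL]; intro x hx
    show ∑ i, x i = 1
    rw [sum_tot]; exact hx.1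
  · rw [hL]; exact connected_compl hn ha ta hg g0
  · rintro L' ⟨h1, h2, h3, h4⟩
    apply SetLike.coe_injective
    rw [hL, line_carrier hn ha ta hg g0 L' h1 h2 h3 h4]

end BetaDF
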